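/- arXiv:2405.03112 — 2 statements merged into one kernel-verified Lean document; each statement's English description precedes it below -/
import Mathlib

section
/- Fix an integer k ≥ 11 and let R be the rainbow k-clique. Then the sequence I(R,n)/binom(n,k) converges as n → ∞, and its limit (the inducibility of R) equals k!/(k^k − k). -/
open Finset Filter

open scoped Classical

section Defs

variable {T : Type}

/-- A coloring of the complete graph is symmetric. -/
def IsSym {V : Type} (χ : V → V → T) : Prop := ∀ u v, χ u v = χ v u

/-- `copyCount k n R χ` : the number of `k`-element subsets of `Fin n` whose coloring
induced by `χ` is isomorphic (as an edge-colored complete graph) to `R`. -/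
noncomputable def copyCount (k n : ℕ) (R : Fin k → Fin k → T) (χ : Fin n → Fin n → T) : ℕ :=
  ((Finset.powersetCard k (Finset.univ : Finset (Fin n))).filter
    (fun S => ∃ φ : Fin k → Fin n, Function.Injective φ ∧ (∀ a, φ a ∈ S) ∧
      ∀ a b : Fin k, a ≠ b → χ (φ a) (φ b) = R a b)).card

/-- `maxCopyCount k n R = I(R,n)` : the maximum of `copyCount` over all symmetric
`T`-colorings of the complete graph on `n` vertices. -/
noncomputable def maxCopyCount [Fintype T] (k n : ℕ) (R : Fin k → Fin k → T) : ℕ :=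
  Finset.sup ((Finset.univ : Finset (Fin n → Fin n → T)).filter (fun χ => IsSym χ))
    (fun χ => copyCount k n R χ)

/-- `vertDeg k n R χ x = d(x)` : the number of `k`-subsets containing `x` whose induced
coloring is isomorphic to `R`. -/
noncomputable def vertDeg (k n : ℕ) (R : Fin k → Fin k → T) (χ : Fin n → Fin n → T)
    (x : Fin n) : ℕ :=
  ((Finset.powersetCard k (Finset.univ : Finset (Fin n))).filter
    (fun S => x ∈ S ∧ ∃ φ : Fin k → Fin n, Function.Injective φ ∧ (∀ a, φ a ∈ S) ∧
      ∀ a b : Fin k, a ≠ b → χ (φ a) (φ b) = R a b)).card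

/-- `embCount k n R χ i x = d_i(x)` : the number of injective color-preserving maps
`φ : Fin k → Fin n` with `φ i = x`. -/
noncomputable def embCount (k n : ℕ) (R : Fin k → Fin k → T) (χ : Fin n → Fin n → T)
    (i : Fin k) (x : Fin n) : ℕ :=
  ((Finset.univ : Finset (Fin k → Fin n)).filter
    (fun φ => Function.Injective φ ∧ φ i = x ∧
      ∀ a b : Fin k, a ≠ b → χ (φ a) (φ b) = R a b)).card

/-- `Nset k n R χ i x = N_i(x)` : the set of vertices `y ≠ x` lying in the image of some
injective color-preserving map `φ : Fin k → Fin n` with `φ i = x`. -/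
noncomputable def Nset (k n : ℕ) (R : Fin k → Fin k → T) (χ : Fin n → Fin n → T)
    (i : Fin k) (x : Fin n) : Finset (Fin n) :=
  (Finset.univ : Finset (Fin n)).filter
    (fun y => y ≠ x ∧ ∃ φ : Fin k → Fin n, Function.Injective φ ∧ φ i = x ∧
      (∀ a b : Fin k, a ≠ b → χ (φ a) (φ b) = R a b) ∧ ∃ a, φ a = y)

/-- `colorDeg χ x c = d_c(x)` : the number of vertices `y ≠ x` with `χ x y = c`. -/
noncomputable def colorDeg {n : ℕ} (χ : Fin n → Fin n → T) (x : Fin n) (c : T) : ℕ :=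
  ((Finset.univ : Finset (Fin n)).filter (fun y => y ≠ x ∧ χ x y = c)).card

end Defs

/-- The rainbow `k`-clique: the edge `ij` gets color `{i,j}`. -/
def rainbowClique (k : ℕ) : Fin k → Fin k → Finset (Fin k) := fun i j => {i, j}

/-- A rainbow graph `G` on `[k]`, viewed as an edge-colored complete graph: edges `ij ∈ E`
get color `{i,j}`, non-edges get color `∅`. -/
noncomputable def rainbowOf {k : ℕ} (G : SimpleGraph (Fin k)) :
    Fin k → Fin k → Finset (Fin k) :=
  fun i j => if G.Adj i j then {i, j} else ∅

/-- `B(x)` : the set of neighbors of `x`, i.e. vertices joined to `x` by a non-`∅` color. -/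
noncomputable def Bset {k n : ℕ} (χ : Fin n → Fin n → Finset (Fin k)) (x : Fin n) :
    Finset (Fin n) :=
  (Finset.univ : Finset (Fin n)).filter (fun y => y ≠ x ∧ χ x y ≠ ∅)

/-- The degree of vertex `i` in the graph `G`. -/
noncomputable def degR {k : ℕ} (G : SimpleGraph (Fin k)) (i : Fin k) : ℕ :=
  ((Finset.univ : Finset (Fin k)).filter (fun j => G.Adj i j)).card

section Inequalities

/-- AM-GM in product form, without roots. -/
theorem prod_le_sum_div_card_pow {ι : Type*} (s : Finset ι) (z : ι → ℝ)
    (hz : ∀ i ∈ s, 0 ≤ z i) : ∏ i ∈ s, z i ≤ ((∑ i ∈ s, z i) / s.card) ^ s.card := by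
  rcases s.eq_empty_or_nonempty with rfl | hs
  · simp
  have hc : (0 : ℝ) < s.card := by exact_mod_cast hs.card_pos
  have h := Real.geom_mean_le_arith_mean s (fun _ => 1) z (fun _ _ => zero_le_one)
    (by simpa using hs.card_pos) hz
  simp only [Real.rpow_one, sum_const, nsmul_eq_mul, mul_one, one_mul] at h
  have hp : 0 ≤ ∏ i ∈ s, z i := prod_nonneg hz
  calc ∏ i ∈ s, z i = ((∏ i ∈ s, z i) ^ ((s.card : ℝ)⁻¹)) ^ s.card :=
        (Real.rpow_inv_natCast_pow hp hs.card_pos.ne').symm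
    _ ≤ _ := pow_le_pow_left₀ (Real.rpow_nonneg hp _) h _

/-- The multinomial expansion of `(∑ v)^k`, with the nonconstant terms bounded below by
AM-GM over cyclic shifts. -/
theorem mul_prod_add_sum_pow_le {k : ℕ} (hk : 2 ≤ k) (v : Fin k → ℝ) (hv : ∀ i, 0 ≤ v i) :
    ((k : ℝ) ^ k - k) * ∏ i, v i + ∑ i, v i ^ k ≤ (∑ i, v i) ^ k := by
  have : NeZero k := ⟨by omega⟩
  have hk0 : (0 : ℝ) < k := by positivity
  set G : (Fin k → Fin k) → ℝ := fun f => ∏ i, v (f i)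
  set D : Finset (Fin k → Fin k) := univ.image (fun i : Fin k => fun _ => i)
  have hinj : Function.Injective (fun i : Fin k => fun _ : Fin k => i) :=
    fun i j h => congrFun h 0
  have hD : ∑ f ∈ D, G f = ∑ i, v i ^ k := by
    rw [sum_image hinj.injOn]
    simp [G]
  have hDcard : D.card = k := by rw [card_image_of_injective _ hinj]; simp
  have hDc : (Dᶜ.card : ℝ) = (k : ℝ) ^ k - k := by
    have h := card_add_card_compl D
    rw [hDcard] at h
    simp only [Fintype.card_fun, Fintype.card_fin] at h
    rw [eq_sub_iff_add_eq']
    exact_mod_cast h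
  have hshift : ∀ s : Fin k, ∑ f ∈ Dᶜ, G (fun i => f i + s) = ∑ f ∈ Dᶜ, G f := by
    intro s
    refine sum_bij' (fun f _ => fun i => f i + s) (fun f _ => fun i => f i - s) ?_ ?_ ?_ ?_ ?_
    · intro f hf
      simp only [D, mem_compl, mem_image, mem_univ, true_and, not_exists] at hf ⊢
      intro j hj
      exact hf (j - s) (by funext i; rw [sub_eq_iff_eq_add]; exact congrFun hj i)
    · intro f hf
      simp only [D, mem_compl, mem_image, mem_univ, true_and, not_exists] at hf ⊢
      intro j hj
      exact hf (j + s) (by funext i; rw [← eq_sub_iff_add_eq]; exact congrFun hj i)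
    · intro f _; simp
    · intro f _; simp
    · intro f _; rfl
  have hamgm : ∀ f : Fin k → Fin k, k * ∏ i, v i ≤ ∑ s : Fin k, G (fun i => f i + s) := by
    intro f
    have h := prod_le_sum_div_card_pow univ (fun s : Fin k => G (fun i => f i + s))
      (fun s _ => prod_nonneg fun i _ => hv _)
    have h2 : ∏ s : Fin k, G (fun i => f i + s) = (∏ i, v i) ^ k := by
      simp only [G]
      rw [Finset.prod_comm]
      have : ∀ i : Fin k, ∏ s : Fin k, v (f i + s) = ∏ j, v j :=
        fun i => Equiv.prod_comp (Equiv.addLeft (f i)) v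
      simp [this]
    rw [h2] at h
    simp only [card_univ, Fintype.card_fin] at h
    have h3 := le_of_pow_le_pow_left₀ (by omega : k ≠ 0)
      (div_nonneg (sum_nonneg fun s _ => prod_nonneg fun i _ => hv _) hk0.le) h
    rw [le_div_iff₀ hk0] at h3
    linarith
  have hmain : (k : ℝ) * (((k : ℝ) ^ k - k) * ∏ i, v i) ≤ k * ∑ f ∈ Dᶜ, G f := by
    calc (k : ℝ) * (((k : ℝ) ^ k - k) * ∏ i, v i)
        = ∑ f ∈ Dᶜ, (k : ℝ) * ∏ i, v i := by
          rw [sum_const, nsmul_eq_mul, hDc]; ring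
      _ ≤ ∑ f ∈ Dᶜ, ∑ s : Fin k, G (fun i => f i + s) := sum_le_sum fun f _ => hamgm f
      _ = ∑ s : Fin k, ∑ f ∈ Dᶜ, G (fun i => f i + s) := sum_comm
      _ = k * ∑ f ∈ Dᶜ, G f := by simp [hshift]
  have hmain' := le_of_mul_le_mul_left hmain hk0
  rw [Fintype.sum_pow, ← sum_add_sum_compl D G, hD]
  linarith

/-- The proportion of `(k-2)`-sets of further vertices that can complete a copy through a
vertex playing a role that is not its own, and a second vertex. -/
noncomputable def minorityDensity (k : ℕ) : ℝ := (2 / (k : ℝ) / ((k - 3 : ℕ) : ℝ)) ^ (k - 3)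

theorem minorityDensity_nonneg (k : ℕ) : 0 ≤ minorityDensity k := by
  unfold minorityDensity; positivity

theorem mul_pow_eq_minorityDensity_mul {k : ℕ} (hk : 3 ≤ k) (n : ℝ) :
    n * (2 / k * n / ((k - 3 : ℕ) : ℝ)) ^ (k - 3) = minorityDensity k * n ^ (k - 2) := by
  obtain ⟨m, rfl⟩ := Nat.exists_eq_add_of_le' hk
  rw [minorityDensity, show m + 3 - 2 = m + 1 by omega, mul_div_right_comm, mul_pow, pow_succ]
  simp only [Nat.add_sub_cancel]
  ring

theorem quintic_le_four_pow (m : ℕ) (hm : 8 ≤ m) :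
    (m + 3) ^ 4 * (m + 2) * 5 ≤ 12 * 4 ^ m := by
  induction m, hm using Nat.le_induction with
  | base => norm_num
  | succ m hm ih =>
    have h1 : (m + 1 + 3) ^ 4 * (m + 1 + 2) ≤ 4 * ((m + 3) ^ 4 * (m + 2)) := by
      obtain ⟨t, rfl⟩ := Nat.exists_eq_add_of_le hm
      ring_nf
      nlinarith [Nat.zero_le t, Nat.zero_le (t^2), Nat.zero_le (t^3), Nat.zero_le (t^4),
        Nat.zero_le (t^5)]
    rw [pow_succ 4 m]
    omega

theorem minorityDensity_bound {k : ℕ} (hk : 11 ≤ k) :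
    (k : ℝ) ^ k * minorityDensity k * (k * (k - 1)) ≤ 12 / 5 := by
  obtain ⟨m, rfl⟩ := Nat.exists_eq_add_of_le' (show 3 ≤ k by omega)
  have hm : 8 ≤ m := by omega
  have hm' : (8 : ℝ) ≤ m := by exact_mod_cast hm
  have hq : ((m : ℝ) + 3) ^ 4 * (m + 2) * 5 ≤ 12 * 4 ^ m := by
    exact_mod_cast quintic_le_four_pow m hm
  have h1 : ((m + 3 : ℕ) : ℝ) ^ (m + 3) * minorityDensity (m + 3)
      = ((m : ℝ) + 3) ^ 3 * (2 / m) ^ m := by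
    unfold minorityDensity
    simp only [Nat.add_sub_cancel]
    push_cast
    rw [pow_add, mul_comm (((m : ℝ) + 3) ^ m), mul_assoc, ← mul_pow]
    congr 2
    field_simp
  have h2 : (2 / (m : ℝ)) ^ m ≤ (1 / 4) ^ m := by
    apply pow_le_pow_left₀ (by positivity)
    rw [div_le_div_iff₀ (by linarith) (by norm_num)]
    linarith
  have h3 : (1 / 4 : ℝ) ^ m * 4 ^ m = 1 := by rw [← mul_pow]; norm_num
  rw [h1]
  push_cast
  calc ((m : ℝ) + 3) ^ 3 * (2 / m) ^ m * ((m + 3) * (m + 3 - 1))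
      = (2 / (m : ℝ)) ^ m * (((m : ℝ) + 3) ^ 4 * (m + 2)) := by ring
    _ ≤ (1 / 4) ^ m * (((m : ℝ) + 3) ^ 4 * (m + 2)) := by gcongr
    _ ≤ (1 / 4) ^ m * (12 / 5 * 4 ^ m) := 
        mul_le_mul_of_nonneg_left (by linarith) (by positivity)
    _ = 12 / 5 * ((1 / 4 : ℝ) ^ m * 4 ^ m) := by ring
    _ = 12 / 5 := by rw [h3, mul_one]

/-- No vertex can spread its degree over several roles. -/
theorem two_mul_pow_lt {k : ℕ} (hk : 11 ≤ k) :
    2 * (1 - 2 / (k : ℝ)) ^ (k - 2) / ((k - 1 : ℕ) : ℝ) ^ (k - 1) < 1 / (k : ℝ) ^ (k - 1) := by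
  obtain ⟨m, rfl⟩ := Nat.exists_eq_add_of_le' (show 3 ≤ k by omega)
  have hm : 8 ≤ m := by omega
  have hm' : (8 : ℝ) ≤ m := by exact_mod_cast hm
  simp only [show m + 3 - 2 = m + 1 by omega, show m + 3 - 1 = m + 2 by omega]
  push_cast
  set r : ℝ := ((m : ℝ) + 2) / (m + 3) with hr
  have hr0 : 0 < r := by positivity
  have h1 : (1 - 2 / ((m : ℝ) + 3)) ≤ r ^ 2 := by
    rw [hr, div_pow, one_sub_div (by positivity), div_le_div_iff₀ (by positivity) (by positivity)]
    nlinarith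
  have h1' : 0 ≤ 1 - 2 / ((m : ℝ) + 3) := by
    rw [sub_nonneg, div_le_one (by positivity)]; linarith
  have h2 : 2 * r ^ m < 1 := by
    have hbin : (2 : ℝ) < (1 + 1 / ((m : ℝ) + 2)) ^ m := by
      have hle : (1 : ℝ) + m * (1 / (m + 2)) + m * (m - 1) / 2 * (1 / (m + 2)) ^ 2
          ≤ (1 + 1 / ((m : ℝ) + 2)) ^ m := by
        have hgen : ∀ (x : ℝ), 0 ≤ x → ∀ n : ℕ,
            1 + n * x + n * (n - 1) / 2 * x ^ 2 ≤ (1 + x) ^ n := by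
          intro x hx n
          induction n with
          | zero => simp
          | succ n ih =>
            rw [pow_succ]
            have := mul_le_mul_of_nonneg_right ih (by linarith : 0 ≤ 1 + x)
            refine le_trans ?_ this
            have hn : 0 ≤ (n : ℝ) * (n - 1) / 2 * x ^ 3 := by
              rcases n with _ | n
              · simp
              · push_cast; simp only [add_sub_cancel_right]; positivity
            push_cast
            nlinarith
        exact hgen _ (by positivity) m
      refine lt_of_lt_of_le ?_ hle
      have : (1 : ℝ) + m * (1 / (m + 2)) + m * (m - 1) / 2 * (1 / (m + 2)) ^ 2 - 2
          = (m ^ 2 - 5 * m - 8) / (2 * (m + 2) ^ 2) := by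
        field
      have h0 : 0 < ((m : ℝ) ^ 2 - 5 * m - 8) / (2 * (m + 2) ^ 2) := by
        apply div_pos <;> nlinarith
      linarith
    have hrinv : r * (1 + 1 / ((m : ℝ) + 2)) = 1 := by rw [hr]; field
    have hrm : r ^ m * (1 + 1 / ((m : ℝ) + 2)) ^ m = 1 := by rw [← mul_pow, hrinv, one_pow]
    nlinarith [pow_pos hr0 m]
  have h3 : 2 * (1 - 2 / ((m : ℝ) + 3)) ^ (m + 1) < r ^ (m + 2) := by
    calc 2 * (1 - 2 / ((m : ℝ) + 3)) ^ (m + 1) ≤ 2 * (r ^ 2) ^ (m + 1) := by gcongr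
      _ = (2 * r ^ m) * r ^ (m + 2) := by rw [← pow_mul, mul_assoc, ← pow_add]; congr 2; omega
      _ < 1 * r ^ (m + 2) := by gcongr
      _ = r ^ (m + 2) := one_mul _
  rw [div_lt_div_iff₀ (by positivity) (by positivity), one_mul]
  calc _ < r ^ (m + 2) * ((m : ℝ) + 3) ^ (m + 2) := by gcongr
    _ = _ := by rw [← mul_pow, hr, div_mul_cancel₀ _ (by positivity)]

end Inequalities

section Embeddings

variable {k : ℕ} {V : Type} [Fintype V]

/-- The injective color-preserving maps from the rainbow `k`-clique. -/
noncomputable def rainbowEmb (χ : V → V → Finset (Fin k)) : Finset (Fin k → V) :=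
  univ.filter fun φ => Function.Injective φ ∧ ∀ a b : Fin k, a ≠ b → χ (φ a) (φ b) = {a, b}

theorem mem_rainbowEmb {χ : V → V → Finset (Fin k)} {φ : Fin k → V} :
    φ ∈ rainbowEmb χ ↔
      Function.Injective φ ∧ ∀ a b : Fin k, a ≠ b → χ (φ a) (φ b) = {a, b} := by
  simp [rainbowEmb]

/-- The rainbow clique is rigid: an embedding is determined by its image. -/
theorem rainbowEmb_eq_of_range_subset (hk : 3 ≤ k) {χ : V → V → Finset (Fin k)} {φ ψ : Fin k → V}
    (hφ : φ ∈ rainbowEmb χ) (hψ : ψ ∈ rainbowEmb χ)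
    (hex : ∀ a, ∃ a', ψ a' = φ a) : φ = ψ := by
  rw [mem_rainbowEmb] at hφ hψ
  funext a
  obtain ⟨a', ha'⟩ := hex a
  by_contra hne
  have haa : a' ≠ a := by rintro rfl; exact hne ha'.symm
  obtain ⟨b, hba, hba'⟩ : ∃ b : Fin k, b ≠ a ∧ b ≠ a' := by
    have : ({a, a'} : Finset (Fin k)).card < (univ : Finset (Fin k)).card := by
      rw [card_univ, Fintype.card_fin]
      exact lt_of_le_of_lt card_le_two (by omega)
    obtain ⟨b, _, hb⟩ := exists_mem_notMem_of_card_lt_card this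
    exact ⟨b, by simp_all, by simp_all⟩
  obtain ⟨b', hb'⟩ := hex b
  have hbb : a' ≠ b' := by
    rintro rfl
    exact hba (hφ.1 (hb'.symm.trans ha'))
  have h1 := hφ.2 a b hba.symm
  rw [← ha', ← hb', hψ.2 a' b' hbb] at h1
  have h2 : a' ∈ ({a, b} : Finset (Fin k)) := h1 ▸ mem_insert_self _ _
  simp only [mem_insert, mem_singleton] at h2
  rcases h2 with h2 | h2
  · exact haa h2
  · exact hba' h2.symm

theorem copyCount_rainbowClique (hk : 3 ≤ k) {n : ℕ} (χ : Fin n → Fin n → Finset (Fin k)) :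
    copyCount k n (rainbowClique k) χ = (rainbowEmb χ).card := by
  symm
  refine card_bij (fun φ _ => univ.image φ) ?_ ?_ ?_
  · intro φ hφ
    have h := mem_rainbowEmb.1 hφ
    simp only [mem_filter, mem_powersetCard, subset_univ, true_and]
    refine ⟨by rw [card_image_of_injective _ h.1]; simp, φ, h.1, ?_, h.2⟩
    exact fun a => mem_image_of_mem _ (mem_univ a)
  · intro φ hφ ψ hψ h
    refine rainbowEmb_eq_of_range_subset hk hφ hψ fun a => ?_
    have : φ a ∈ univ.image ψ := h ▸ mem_image_of_mem _ (mem_univ a)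
    simpa using this
  · intro S hS
    simp only [mem_filter, mem_powersetCard, subset_univ, true_and] at hS
    obtain ⟨hc, φ, hinj, hmem, hcol⟩ := hS
    refine ⟨φ, mem_rainbowEmb.2 ⟨hinj, hcol⟩, ?_⟩
    apply eq_of_subset_of_card_le
    · intro v hv
      obtain ⟨a, _, rfl⟩ := mem_image.1 hv
      exact hmem a
    · rw [card_image_of_injective _ hinj, hc]; simp

/-- `I(R,n)` for the rainbow `k`-clique `R`. -/
noncomputable def maxRainbow (k n : ℕ) : ℕ := maxCopyCount k n (rainbowClique k)

theorem exists_card_rainbowEmb_eq (hk : 3 ≤ k) (n : ℕ) :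
    ∃ χ : Fin n → Fin n → Finset (Fin k), IsSym χ ∧ (rainbowEmb χ).card = maxRainbow k n := by
  have hne : ((univ : Finset (Fin n → Fin n → Finset (Fin k))).filter
      (fun χ => IsSym χ)).Nonempty := ⟨fun _ _ => ∅, mem_filter.2 ⟨mem_univ _, fun _ _ => rfl⟩⟩
  obtain ⟨χ, hχ, h⟩ := exists_mem_eq_sup _ hne (fun χ => copyCount k n (rainbowClique k) χ)
  refine ⟨χ, by simpa using hχ, ?_⟩
  rw [← copyCount_rainbowClique hk]
  exact h.symm

theorem card_rainbowEmb_le_maxRainbow (hk : 3 ≤ k) {χ : V → V → Finset (Fin k)} (hχ : IsSym χ)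
    {n : ℕ} (hn : Fintype.card V ≤ n) : (rainbowEmb χ).card ≤ maxRainbow k n := by
  rcases isEmpty_or_nonempty V with hV | hV
  · have : IsEmpty (Fin k → V) := ⟨fun φ => hV.elim (φ ⟨0, by omega⟩)⟩
    have h0 : rainbowEmb χ = ∅ := eq_empty_of_isEmpty _
    simp [h0]
  obtain ⟨g⟩ : Nonempty (V ↪ Fin n) :=
    Function.Embedding.nonempty_of_card_le (by simpa using hn)
  set χ' : Fin n → Fin n → Finset (Fin k) :=
    fun u v => χ (Function.invFun g u) (Function.invFun g v) with hχ'
  have hinv : ∀ x, Function.invFun g (g x) = x := Function.leftInverse_invFun g.injective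
  have hsym : IsSym χ' := fun u v => hχ _ _
  calc (rainbowEmb χ).card ≤ (rainbowEmb χ').card := by
        refine card_le_card_of_injOn (fun φ => g ∘ φ) ?_ ?_
        · intro φ hφ
          have hφ := mem_rainbowEmb.1 hφ
          refine mem_rainbowEmb.2 ⟨g.injective.comp hφ.1, fun a b hab => ?_⟩
          simp only [hχ', Function.comp_apply, hinv]
          exact hφ.2 a b hab
        · intro φ _ ψ _ h
          exact g.injective.comp_left h
    _ = copyCount k n (rainbowClique k) χ' := (copyCount_rainbowClique hk _).symm
    _ ≤ maxRainbow k n :=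
        le_sup (f := fun χ => copyCount k n (rainbowClique k) χ) (by simpa using hsym)

/-- Embeddings that stay inside a vertex subset. -/
theorem card_rainbowEmb_filter_mem_le (hk : 3 ≤ k) {χ : V → V → Finset (Fin k)} (hχ : IsSym χ)
    (W : Finset V) :
    ((rainbowEmb χ).filter fun φ => ∀ a, φ a ∈ W).card ≤ maxRainbow k W.card := by
  refine le_trans ?_ (card_rainbowEmb_le_maxRainbow hk (V := W)
    (χ := fun u v => χ u v) (fun u v => hχ _ _) (n := W.card) (by simp))
  refine card_le_card_of_surjOn (fun φ a => (φ a : V)) ?_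
  intro φ hφ
  simp only [coe_filter, Set.mem_ofPred_eq] at hφ
  obtain ⟨hφ, hW⟩ := hφ
  have hφ := mem_rainbowEmb.1 hφ
  refine ⟨fun a => ⟨φ a, hW a⟩, ?_, rfl⟩
  refine mem_coe.2 (mem_rainbowEmb.2 ⟨fun a b h => hφ.1 (by simpa using h), hφ.2⟩)

/-- The recursive blow-up. -/
theorem pow_add_mul_maxRainbow_le (hk : 3 ≤ k) {n m : ℕ} (h : k * m ≤ n) :
    m ^ k + k * maxRainbow k m ≤ maxRainbow k n := by
  obtain ⟨χ₀, hsym, hcard⟩ := exists_card_rainbowEmb_eq hk m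
  set χ : Fin k × Fin m → Fin k × Fin m → Finset (Fin k) :=
    fun p q => if p.1 = q.1 then χ₀ p.2 q.2 else {p.1, q.1} with hχ
  have hχsym : IsSym χ := by
    intro p q
    simp only [hχ]
    by_cases hpq : p.1 = q.1
    · simp [hpq, hsym p.2 q.2]
    · rw [if_neg hpq, if_neg (Ne.symm hpq), pair_comm]
  refine le_trans ?_ (card_rainbowEmb_le_maxRainbow hk hχsym (n := n) (by simpa using h))
  have hcount : m ^ k + k * maxRainbow k m
      = ((univ : Finset (Fin k → Fin m)).disjSum
          ((univ : Finset (Fin k)) ×ˢ rainbowEmb χ₀)).card := by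
    simp [hcard]
  rw [hcount]
  refine card_le_card_of_injOn
    (Sum.elim (fun f a => (a, f a)) (fun p a => (p.1, p.2 a))) ?_ ?_
  · rintro (f | ⟨i, φ⟩) hx
    · refine mem_rainbowEmb.2 ⟨fun a b hab => (Prod.ext_iff.1 hab).1, fun a b hab => ?_⟩
      simp [hχ, hab]
    · have hφ : φ ∈ rainbowEmb χ₀ := by simpa using hx
      have hφ := mem_rainbowEmb.1 hφ
      refine mem_rainbowEmb.2 ⟨fun a b hab => hφ.1 (Prod.ext_iff.1 hab).2, fun a b hab => ?_⟩
      simpa [hχ] using hφ.2 a b hab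
  · have h01 : (⟨0, by omega⟩ : Fin k) ≠ ⟨1, by omega⟩ := by simp
    rintro (f | ⟨i, φ⟩) - (f' | ⟨i', φ'⟩) - hxy
    · congr 1
      funext a
      exact (Prod.ext_iff.1 (congrFun hxy a)).2
    · have h (a : Fin k) : a = i' := (Prod.ext_iff.1 (congrFun hxy a)).1
      exact absurd ((h _).trans (h _).symm) h01
    · have h (a : Fin k) : i = a := (Prod.ext_iff.1 (congrFun hxy a)).1
      exact absurd ((h _).symm.trans (h _)) h01
    · congr 2
      · exact (Prod.ext_iff.1 (congrFun hxy ⟨0, by omega⟩)).1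
      · funext a
        exact (Prod.ext_iff.1 (congrFun hxy a)).2

end Embeddings

section Roles

variable {k : ℕ} {V : Type} [Fintype V] (χ : V → V → Finset (Fin k))

/-- The vertices joined to `x` by color `c`. -/
noncomputable def colorNbr (x : V) (c : Finset (Fin k)) : Finset V :=
  univ.filter fun y => χ x y = c

/-- The vertices joined to `x` by a color `{a,l}` with `l ∈ C`. -/
noncomputable def starNbr (x : V) (a : Fin k) (C : Finset (Fin k)) : Finset V :=
  univ.filter fun y => ∃ l ∈ C, χ x y = {a, l}

variable {χ}

theorem pair_right_injective {α : Type*} [DecidableEq α] {a b c : α}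
    (h : ({a, b} : Finset α) = {a, c}) : b = c := by
  have h1 : b ∈ ({a, c} : Finset α) := h ▸ (by simp)
  have h2 : c ∈ ({a, b} : Finset α) := h ▸ (by simp)
  simp only [mem_insert, mem_singleton] at h1 h2
  rcases h1 with rfl | h1
  · rcases h2 with h2 | h2 <;> exact h2.symm
  · exact h1

theorem card_starNbr (x : V) (a : Fin k) (C : Finset (Fin k)) :
    (starNbr χ x a C).card = ∑ l ∈ C, (colorNbr χ x {a, l}).card := by
  rw [← card_biUnion]
  · congr 1
    ext y
    simp [starNbr, colorNbr]
  · intro l _ l' _ hne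
    rw [Function.onFun, Finset.disjoint_left]
    intro y hy hy'
    simp only [colorNbr, mem_filter, mem_univ, true_and] at hy hy'
    exact hne (pair_right_injective (hy.symm.trans hy'))

theorem card_starNbr_add_le (x : V) {a i : Fin k} {C D : Finset (Fin k)} (hai : a ≠ i)
    (hC : i ∉ C) : (starNbr χ x i D).card + (starNbr χ x a C).card ≤ Fintype.card V := by
  rw [← card_union_of_disjoint]
  · exact card_le_univ _
  · rw [Finset.disjoint_left]
    intro y hy hy'
    simp only [starNbr, mem_filter, mem_univ, true_and] at hy hy'
    obtain ⟨j, _, h1⟩ := hy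
    obtain ⟨l, hl, h2⟩ := hy'
    have : i ∈ ({a, l} : Finset (Fin k)) := by rw [← h2, h1]; simp
    simp only [mem_insert, mem_singleton] at this
    rcases this with h | h
    · exact hai h.symm
    · exact hC (h ▸ hl)

theorem sum_card_starNbr_le (x : V) :
    ∑ i, (starNbr χ x i (univ.erase i)).card ≤ 2 * Fintype.card V := by
  have hcol : ∀ y : V, (univ.filter fun i : Fin k => ∃ l ∈ univ.erase i, χ x y = {i, l}).card
      ≤ 2 := by
    intro y
    rcases (univ.filter fun i : Fin k =>
      ∃ l ∈ univ.erase i, χ x y = {i, l}).eq_empty_or_nonempty with h | ⟨i, hi⟩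
    · rw [h, card_empty]; omega
    · obtain ⟨l, _, hl⟩ := (mem_filter.1 hi).2
      refine le_trans (card_le_card (t := χ x y) ?_) (hl ▸ card_le_two)
      intro j hj
      obtain ⟨l', _, hl'⟩ := (mem_filter.1 hj).2
      rw [hl']
      exact mem_insert_self _ _
  calc ∑ i, (starNbr χ x i (univ.erase i)).card
      = ∑ y : V, (univ.filter fun i : Fin k => ∃ l ∈ univ.erase i, χ x y = {i, l}).card := by
        simp only [starNbr, card_filter]
        exact sum_comm
    _ ≤ ∑ _y : V, 2 := sum_le_sum fun y _ => hcol y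
    _ = 2 * Fintype.card V := by simp [mul_comm]

/-- The embeddings that send `a` to `x`. -/
theorem card_rainbowEmb_through_le (x : V) (a : Fin k) :
    ((rainbowEmb χ).filter fun φ => φ a = x).card
      ≤ ∏ l ∈ univ.erase a, (colorNbr χ x {a, l}).card := by
  calc ((rainbowEmb χ).filter fun φ => φ a = x).card
      ≤ (Fintype.piFinset fun l => if l = a then {x} else colorNbr χ x {a, l}).card := by
        refine card_le_card fun φ hφ => ?_
        obtain ⟨hφ, hx⟩ := mem_filter.1 hφ
        have hφ := mem_rainbowEmb.1 hφ
        rw [Fintype.mem_piFinset]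
        intro l
        split_ifs with h
        · simp [h, hx]
        · simp only [colorNbr, mem_filter, mem_univ, true_and]
          rw [← hx]
          exact hφ.2 a l (Ne.symm h)
    _ = _ := by
        rw [Fintype.card_piFinset, ← mul_prod_erase univ _ (mem_univ a)]
        simp only [if_true, card_singleton, one_mul]
        exact prod_congr rfl fun l hl => by rw [if_neg (ne_of_mem_erase hl)]

/-- The embeddings that send `a` to `x` and `b` to `y`. -/
theorem card_rainbowEmb_through_pair_le (x y : V) {a b : Fin k} (hab : a ≠ b) :
    ((rainbowEmb χ).filter fun φ => φ a = x ∧ φ b = y).card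
      ≤ ∏ l ∈ (univ.erase a).erase b, (colorNbr χ x {a, l}).card := by
  calc ((rainbowEmb χ).filter fun φ => φ a = x ∧ φ b = y).card
      ≤ (Fintype.piFinset fun l => if l = a then {x} else if l = b then {y} else
          colorNbr χ x {a, l}).card := by
        refine card_le_card fun φ hφ => ?_
        obtain ⟨hφ, hx, hy⟩ := mem_filter.1 hφ
        have hφ := mem_rainbowEmb.1 hφ
        rw [Fintype.mem_piFinset]
        intro l
        split_ifs with h h'
        · simp [h, hx]
        · simp [h', hy]
        · simp only [colorNbr, mem_filter, mem_univ, true_and]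
          rw [← hx]
          exact hφ.2 a l (Ne.symm h)
    _ = _ := by
        rw [Fintype.card_piFinset, ← mul_prod_erase univ _ (mem_univ a),
          ← mul_prod_erase (univ.erase a) _ (mem_erase.2 ⟨hab.symm, mem_univ b⟩)]
        simp only [if_true, card_singleton, one_mul, if_neg hab.symm]
        refine prod_congr rfl fun l hl => ?_
        rw [if_neg (ne_of_mem_erase (mem_of_mem_erase hl)), if_neg (ne_of_mem_erase hl)]

/-- `i` is a role of `x` if almost all colors at `x` contain `i`. -/
def IsRole (χ : V → V → Finset (Fin k)) (x : V) (i : Fin k) : Prop :=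
  (1 - 2 / (k : ℝ)) * Fintype.card V ≤ (starNbr χ x i (univ.erase i)).card

/-- A vertex of large degree has a role. -/
theorem exists_isRole (hk : 11 ≤ k) (x : V)
    (hx : ((Fintype.card V : ℝ) / k) ^ (k - 1)
      ≤ ∑ i, (((rainbowEmb χ).filter fun φ => φ i = x).card : ℝ)) :
    ∃ i, IsRole χ x i := by
  by_contra! hcon
  simp only [IsRole, not_le] at hcon
  have : Nonempty V := ⟨x⟩
  set n : ℝ := (Fintype.card V : ℝ) with hn
  have hn0 : 0 < n := by rw [hn]; exact_mod_cast Fintype.card_pos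
  set t : ℝ := 1 - 2 / (k : ℝ) with ht
  have hk' : (11 : ℝ) ≤ k := by exact_mod_cast hk
  have ht0 : 0 ≤ t := by
    rw [ht, sub_nonneg, div_le_one (by linarith)]; linarith
  set s : Fin k → ℝ := fun i => ((starNbr χ x i (univ.erase i)).card : ℝ) with hs
  have hs0 : ∀ i, 0 ≤ s i := fun i => by positivity
  have hs2 : ∑ i, s i ≤ 2 * n := by
    have := sum_card_starNbr_le (χ := χ) x
    simp only [hs, hn]
    exact_mod_cast this
  have hc0 : (0 : ℝ) < ((k - 1 : ℕ) : ℝ) := by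
    exact_mod_cast (by omega : 0 < k - 1)
  have hdeg : ∀ i, (((rainbowEmb χ).filter fun φ => φ i = x).card : ℝ)
      ≤ s i * ((t * n) ^ (k - 2) / ((k - 1 : ℕ) : ℝ) ^ (k - 1)) := by
    intro i
    calc (((rainbowEmb χ).filter fun φ => φ i = x).card : ℝ)
        ≤ ∏ l ∈ univ.erase i, ((colorNbr χ x {i, l}).card : ℝ) := by
          exact_mod_cast card_rainbowEmb_through_le x i
      _ ≤ (s i / ((k - 1 : ℕ) : ℝ)) ^ (k - 1) := by
          have h := prod_le_sum_div_card_pow (univ.erase i)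
            (fun l => ((colorNbr χ x {i, l}).card : ℝ)) (fun _ _ => by positivity)
          rw [card_erase_of_mem (mem_univ i), card_univ, Fintype.card_fin] at h
          simp only [hs, card_starNbr]
          push_cast at h ⊢
          exact h
      _ = s i * (s i ^ (k - 2) / ((k - 1 : ℕ) : ℝ) ^ (k - 1)) := by
          rw [div_pow, ← mul_div_assoc, ← pow_succ', show k - 2 + 1 = k - 1 by omega]
      _ ≤ _ := by
          have := pow_le_pow_left₀ (hs0 i) (hcon i).le (k - 2)
          have h0 := hs0 i
          gcongr
  have h1 : (n / k) ^ (k - 1) ≤ n ^ (k - 1) *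
      (2 * t ^ (k - 2) / ((k - 1 : ℕ) : ℝ) ^ (k - 1)) := by
    calc (n / k) ^ (k - 1) ≤ _ := hx
      _ ≤ ∑ i, s i * ((t * n) ^ (k - 2) / ((k - 1 : ℕ) : ℝ) ^ (k - 1)) :=
          sum_le_sum fun i _ => hdeg i
      _ = (∑ i, s i) * ((t * n) ^ (k - 2) / ((k - 1 : ℕ) : ℝ) ^ (k - 1)) := by
          rw [sum_mul]
      _ ≤ (2 * n) * ((t * n) ^ (k - 2) / ((k - 1 : ℕ) : ℝ) ^ (k - 1)) := by gcongr
      _ = _ := by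
          rw [show k - 1 = k - 2 + 1 by omega, mul_pow]; ring
  have h2 := mul_lt_mul_of_pos_left (two_mul_pow_lt hk) (pow_pos hn0 (k - 1))
  rw [div_pow, div_eq_mul_one_div] at h1
  linarith

theorem IsRole.card_pair_le (hk : 11 ≤ k) {x : V} {i : Fin k} (hi : IsRole χ x i) (y : V)
    {a b : Fin k} (hai : a ≠ i) (hab : a ≠ b) :
    (((rainbowEmb χ).filter fun φ => φ a = x ∧ φ b = y).card : ℝ)
      ≤ minorityDensity k * (Fintype.card V : ℝ) ^ (k - 2) := by
  set n : ℝ := (Fintype.card V : ℝ) with hn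
  obtain ⟨C', hC'⟩ : ∃ C' : Finset (Fin k), C' = (univ.erase a).erase b := ⟨_, rfl⟩
  have hcard' : C'.card = k - 2 := by
    rw [hC', card_erase_of_mem (mem_erase.2 ⟨hab.symm, mem_univ b⟩),
      card_erase_of_mem (mem_univ a), card_univ, Fintype.card_fin]
    omega
  obtain ⟨l₀, hl₀, hil⟩ : ∃ l₀ ∈ C', i = b ∨ i = l₀ := by
    by_cases hib : i = b
    · obtain ⟨l, hl⟩ : C'.Nonempty := card_pos.1 (by omega)
      exact ⟨l, hl, Or.inl hib⟩
    · exact ⟨i, by simp [hC', hib, Ne.symm hai], Or.inr rfl⟩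
  obtain ⟨C, hC⟩ : ∃ C, C = C'.erase l₀ := ⟨_, rfl⟩
  have hcard : C.card = k - 3 := by rw [hC, card_erase_of_mem hl₀, hcard']; omega
  have hiC : i ∉ C := by
    rcases hil with rfl | rfl
    · simp [hC, hC']
    · simp [hC]
  have hsum : ∑ l ∈ C, ((colorNbr χ x {a, l}).card : ℝ) ≤ 2 / k * n := by
    have h1 := card_starNbr_add_le (χ := χ) x (D := univ.erase i) hai hiC
    rw [card_starNbr x a C] at h1
    have h2 : ((starNbr χ x i (univ.erase i)).card : ℝ)
        + ∑ l ∈ C, ((colorNbr χ x {a, l}).card : ℝ) ≤ n := by rw [hn]; exact_mod_cast h1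
    have h3 := hi
    rw [IsRole, ← hn] at h3
    linarith
  calc (((rainbowEmb χ).filter fun φ => φ a = x ∧ φ b = y).card : ℝ)
      ≤ ∏ l ∈ C', ((colorNbr χ x {a, l}).card : ℝ) := by
        rw [hC']
        exact_mod_cast card_rainbowEmb_through_pair_le x y hab
    _ = (colorNbr χ x {a, l₀}).card * ∏ l ∈ C, ((colorNbr χ x {a, l}).card : ℝ) :=
        by rw [hC, mul_prod_erase C' (fun l => ((colorNbr χ x {a, l}).card : ℝ)) hl₀]
    _ ≤ n * (2 / k * n / ((k - 3 : ℕ) : ℝ)) ^ (k - 3) := by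
        have h := prod_le_sum_div_card_pow C
            (fun l => ((colorNbr χ x {a, l}).card : ℝ)) (fun _ _ => by positivity)
        rw [hcard] at h
        have h4 : ((colorNbr χ x {a, l₀}).card : ℝ) ≤ n := by
          rw [hn]; exact_mod_cast card_le_univ _
        have h6 : (0 : ℝ) ≤ ∏ l ∈ C, ((colorNbr χ x {a, l}).card : ℝ) :=
          prod_nonneg fun _ _ => Nat.cast_nonneg _
        refine mul_le_mul h4 (h.trans (pow_le_pow_left₀ (by positivity) ?_ _)) h6
          (Nat.cast_nonneg _)
        exact div_le_div_of_nonneg_right hsum (Nat.cast_nonneg _)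
    _ = _ := mul_pow_eq_minorityDensity_mul (by omega) n

theorem IsRole.card_through_le (hk : 11 ≤ k) {x : V} {i : Fin k} (hi : IsRole χ x i)
    {a : Fin k} (hai : a ≠ i) :
    (((rainbowEmb χ).filter fun φ => φ a = x).card : ℝ)
      ≤ minorityDensity k * (Fintype.card V : ℝ) ^ (k - 1) := by
  have h : ((rainbowEmb χ).filter fun φ => φ a = x).card
      = ∑ y : V, ((rainbowEmb χ).filter fun φ => φ a = x ∧ φ i = y).card := by
    rw [card_eq_sum_card_fiberwise (f := fun φ => φ i) (t := univ) (by simp)]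
    simp only [filter_filter]
  rw [h]
  push_cast
  calc ∑ y : V, (((rainbowEmb χ).filter fun φ => φ a = x ∧ φ i = y).card : ℝ)
      ≤ ∑ _y : V, minorityDensity k * (Fintype.card V : ℝ) ^ (k - 2) :=
        sum_le_sum fun y _ => hi.card_pair_le hk y hai hai
    _ = _ := by
        rw [sum_const, nsmul_eq_mul, card_univ, show k - 1 = k - 2 + 1 by omega]
        ring

end Roles

section Counting

variable {k : ℕ} {V : Type} [Fintype V] {χ : V → V → Finset (Fin k)} {ρ : V → Fin k}

/-- The vertices of role `i`. -/
noncomputable def rolePart (ρ : V → Fin k) (i : Fin k) : Finset V := univ.filter fun x => ρ x = i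

theorem mem_rolePart {i : Fin k} {x : V} : x ∈ rolePart ρ i ↔ ρ x = i := by simp [rolePart]

theorem sum_card_rolePart : ∑ i, (rolePart ρ i).card = Fintype.card V :=
  (card_eq_sum_card_fiberwise (f := ρ) (s := univ) (t := univ) (by simp)).symm

/-- The transversals of the role partition. -/
noncomputable def transversals (ρ : V → Fin k) : Finset (Fin k → V) :=
  Fintype.piFinset (rolePart ρ)

theorem mem_transversals {φ : Fin k → V} : φ ∈ transversals ρ ↔ ∀ a, ρ (φ a) = a := by
  simp [transversals, mem_rolePart]

/-- The transversals that are not copies of the rainbow clique. -/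
noncomputable def lostTransversals (χ : V → V → Finset (Fin k)) (ρ : V → Fin k) :
    Finset (Fin k → V) :=
  (transversals ρ).filter fun φ => ∃ a b, a ≠ b ∧ χ (φ a) (φ b) ≠ {a, b}

/-- The pairs of vertices whose color disagrees with their roles. -/
noncomputable def badPairs (χ : V → V → Finset (Fin k)) (ρ : V → Fin k) : Finset (V × V) :=
  univ.filter fun p => ρ p.1 ≠ ρ p.2 ∧ χ p.1 p.2 ≠ {ρ p.1, ρ p.2}

/-- The embeddings that are neither transversals nor inside a part. -/
noncomputable def mixedEmb (χ : V → V → Finset (Fin k)) (ρ : V → Fin k) : Finset (Fin k → V) :=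
  (rainbowEmb χ).filter fun φ => ¬ (∀ a, ρ (φ a) = a) ∧ ¬ ∃ i, ∀ a, φ a ∈ rolePart ρ i

theorem eq_self_of_pair_eq (hk : 3 ≤ k) {σ : Fin k → Fin k}
    (h : ∀ a b, σ a ≠ σ b → ({a, b} : Finset (Fin k)) = {σ a, σ b})
    (hnc : ¬ ∃ i, ∀ a, σ a = i) (a : Fin k) : σ a = a := by
  by_contra hne
  obtain ⟨b, hb⟩ : ∃ b, σ b ≠ σ a := by
    by_contra! hcon
    exact hnc ⟨σ a, hcon⟩
  have hab := h a b hb.symm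
  have h1 : σ a ∈ ({a, b} : Finset (Fin k)) := hab ▸ mem_insert_self _ _
  have h2 : a ∈ ({σ a, σ b} : Finset (Fin k)) := hab ▸ mem_insert_self _ _
  simp only [mem_insert, mem_singleton] at h1 h2
  have h1 : σ a = b := h1.resolve_left hne
  have h2 : a = σ b := h2.resolve_left (Ne.symm hne)
  have hba : b ≠ a := fun hba => hne (h1.trans hba)
  obtain ⟨c, hca, hcb⟩ : ∃ c : Fin k, c ≠ a ∧ c ≠ b := by
    have : ({a, b} : Finset (Fin k)).card < (univ : Finset (Fin k)).card := by
      rw [card_univ, Fintype.card_fin]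
      exact lt_of_le_of_lt card_le_two (by omega)
    obtain ⟨c, _, hc⟩ := exists_mem_notMem_of_card_lt_card this
    exact ⟨c, by simp_all, by simp_all⟩
  by_cases hc : σ c = σ a
  · have h3 := h b c (fun h => hb (h.trans hc))
    have h4 : σ b ∈ ({b, c} : Finset (Fin k)) := h3 ▸ mem_insert_self _ _
    rw [← h2] at h4
    simp only [mem_insert, mem_singleton] at h4
    rcases h4 with h4 | h4
    · exact hba h4.symm
    · exact hca h4.symm
  · have h3 := h a c (Ne.symm hc)
    have h4 : σ a ∈ ({a, c} : Finset (Fin k)) := h3 ▸ mem_insert_self _ _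
    rw [h1] at h4
    simp only [mem_insert, mem_singleton] at h4
    rcases h4 with h4 | h4
    · exact hba h4
    · exact hcb h4.symm

theorem exists_badPair_of_mem_mixedEmb (hk : 3 ≤ k) {φ : Fin k → V}
    (hφ : φ ∈ mixedEmb χ ρ) :
    ∃ a b, a < b ∧ (φ a, φ b) ∈ badPairs χ ρ ∧ χ (φ a) (φ b) = {a, b} := by
  obtain ⟨hφ, hid, hnc⟩ := mem_filter.1 hφ
  have hφ := mem_rainbowEmb.1 hφ
  by_contra! hcon
  refine hid (eq_self_of_pair_eq hk (σ := fun a => ρ (φ a)) ?_ (by simpa [mem_rolePart] using hnc))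
  intro a b hρ
  have hab : a ≠ b := by rintro rfl; exact hρ rfl
  by_contra hne
  have hbad : (φ a, φ b) ∈ badPairs χ ρ := by
    simp only [badPairs, mem_filter, mem_univ, true_and]
    exact ⟨hρ, by rw [hφ.2 a b hab]; exact hne⟩
  have hbad' : (φ b, φ a) ∈ badPairs χ ρ := by
    simp only [badPairs, mem_filter, mem_univ, true_and]
    refine ⟨hρ.symm, ?_⟩
    rw [hφ.2 b a hab.symm, pair_comm b a, pair_comm (ρ (φ b))]
    exact hne
  rcases lt_or_gt_of_ne hab with hlt | hlt
  · exact hcon a b hlt hbad (hφ.2 a b hab)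
  · exact hcon b a hlt hbad' (hφ.2 b a hab.symm)

theorem card_lt_pairs_le_one (c : Finset (Fin k)) :
    ((univ : Finset (Fin k × Fin k)).filter fun q => q.1 < q.2 ∧ c = {q.1, q.2}).card ≤ 1 := by
  rw [card_le_one]
  rintro ⟨a, b⟩ h ⟨a', b'⟩ h'
  simp only [mem_filter, mem_univ, true_and] at h h'
  have heq : ({a, b} : Finset (Fin k)) = {a', b'} := h.2.symm.trans h'.2
  have h1 : a ∈ ({a', b'} : Finset (Fin k)) := heq ▸ (by simp)
  have h2 : b ∈ ({a', b'} : Finset (Fin k)) := heq ▸ (by simp)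
  simp only [mem_insert, mem_singleton] at h1 h2
  have := h.1
  have := h'.1
  rw [Prod.mk.injEq]
  grind

theorem card_mixedEmb_le (hk : 11 ≤ k) (hρ : ∀ x, IsRole χ x (ρ x)) :
    ((mixedEmb χ ρ).card : ℝ)
      ≤ (badPairs χ ρ).card * (minorityDensity k * (Fintype.card V : ℝ) ^ (k - 2)) := by
  set Q : V × V → Finset (Fin k × Fin k) :=
    fun p => univ.filter fun q => q.1 < q.2 ∧ χ p.1 p.2 = {q.1, q.2} with hQ
  set F : V × V → Fin k × Fin k → Finset (Fin k → V) :=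
    fun p q => (rainbowEmb χ).filter fun φ => φ q.1 = p.1 ∧ φ q.2 = p.2 with hF
  have hsub : mixedEmb χ ρ ⊆ (badPairs χ ρ).biUnion fun p => (Q p).biUnion fun q => F p q := by
    intro φ hφ
    obtain ⟨a, b, hlt, hbad, hcol⟩ := exists_badPair_of_mem_mixedEmb (by omega) hφ
    refine mem_biUnion.2 ⟨_, hbad, mem_biUnion.2 ⟨(a, b), ?_, ?_⟩⟩
    · exact mem_filter.2 ⟨mem_univ _, hlt, hcol⟩
    · exact mem_filter.2 ⟨(mem_filter.1 hφ).1, rfl, rfl⟩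
  have hFle : ∀ p ∈ badPairs χ ρ, ∀ q ∈ Q p,
      ((F p q).card : ℝ) ≤ minorityDensity k * (Fintype.card V : ℝ) ^ (k - 2) := by
    intro p hp q hq
    obtain ⟨_, hp1, hp2⟩ := mem_filter.1 hp
    obtain ⟨_, hlt, hcol⟩ := mem_filter.1 hq
    by_cases h1 : q.1 = ρ p.1
    · have h2 : q.2 ≠ ρ p.2 := fun h2 => hp2 (by rw [hcol, h1, h2])
      have h := (hρ p.2).card_pair_le hk p.1 h2 hlt.ne'
      simp only [and_comm (a := _ = p.2)] at h
      exact h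
    · exact (hρ p.1).card_pair_le hk p.2 h1 hlt.ne
  have hpos : 0 ≤ minorityDensity k * (Fintype.card V : ℝ) ^ (k - 2) :=
    mul_nonneg (minorityDensity_nonneg k) (by positivity)
  calc ((mixedEmb χ ρ).card : ℝ)
      ≤ ∑ p ∈ badPairs χ ρ, ∑ q ∈ Q p, ((F p q).card : ℝ) := by
        exact_mod_cast (card_le_card hsub).trans
          (card_biUnion_le.trans (sum_le_sum fun p _ => card_biUnion_le))
    _ ≤ ∑ p ∈ badPairs χ ρ, minorityDensity k * (Fintype.card V : ℝ) ^ (k - 2) := by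
        refine sum_le_sum fun p hp => (sum_le_sum (hFle p hp)).trans ?_
        rw [sum_const, nsmul_eq_mul]
        have : ((Q p).card : ℝ) ≤ 1 := by exact_mod_cast card_lt_pairs_le_one _
        exact mul_le_of_le_one_left hpos this
    _ = _ := by rw [sum_const, nsmul_eq_mul]

/-- Most embeddings are transversals. -/
theorem card_rainbowEmb_sub_le (hk : 11 ≤ k) (hρ : ∀ x, IsRole χ x (ρ x)) :
    ((rainbowEmb χ).card : ℝ) ≤ ((rainbowEmb χ).filter fun φ => ∀ a, ρ (φ a) = a).card
      + k * (minorityDensity k * (Fintype.card V : ℝ) ^ k) := by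
  have hsub : (rainbowEmb χ).filter (fun φ => ¬ ∀ a, ρ (φ a) = a) ⊆
      (univ : Finset (Fin k)).biUnion fun a => (univ.filter fun x => a ≠ ρ x).biUnion fun x =>
        (rainbowEmb χ).filter fun φ => φ a = x := by
    intro φ hφ
    obtain ⟨hφ, h⟩ := mem_filter.1 hφ
    push Not at h
    obtain ⟨a, ha⟩ := h
    exact mem_biUnion.2 ⟨a, mem_univ _, mem_biUnion.2 ⟨φ a, mem_filter.2 ⟨mem_univ _, ha.symm⟩,
      mem_filter.2 ⟨hφ, rfl⟩⟩⟩
  have hle : (((rainbowEmb χ).filter (fun φ => ¬ ∀ a, ρ (φ a) = a)).card : ℝ)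
      ≤ k * (minorityDensity k * (Fintype.card V : ℝ) ^ k) := by
    calc (((rainbowEmb χ).filter (fun φ => ¬ ∀ a, ρ (φ a) = a)).card : ℝ)
        ≤ ∑ a : Fin k, ∑ x ∈ univ.filter fun x => a ≠ ρ x,
            (((rainbowEmb χ).filter fun φ => φ a = x).card : ℝ) := by
          exact_mod_cast (card_le_card hsub).trans
            (card_biUnion_le.trans (sum_le_sum fun p _ => card_biUnion_le))
      _ ≤ ∑ a : Fin k, ∑ x ∈ univ.filter fun x => a ≠ ρ x,
            minorityDensity k * (Fintype.card V : ℝ) ^ (k - 1) :=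
          sum_le_sum fun a _ => sum_le_sum fun x hx =>
            (hρ x).card_through_le hk (mem_filter.1 hx).2
      _ ≤ ∑ a : Fin k, ∑ x : V, minorityDensity k * (Fintype.card V : ℝ) ^ (k - 1) :=
          sum_le_sum fun a _ => sum_le_sum_of_subset_of_nonneg (filter_subset _ _)
            fun _ _ _ => mul_nonneg (minorityDensity_nonneg k) (by positivity)
      _ = _ := by
          have hpow : (Fintype.card V : ℝ) ^ k
              = Fintype.card V * (Fintype.card V : ℝ) ^ (k - 1) := by
            rw [← pow_succ', Nat.sub_add_cancel (by omega)]
          simp only [sum_const, nsmul_eq_mul, card_univ, Fintype.card_fin]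
          rw [hpow]
          ring
  have hsplit := card_filter_add_card_filter_not (s := rainbowEmb χ) (fun φ => ∀ a, ρ (φ a) = a)
  rw [← hsplit]
  push_cast
  linarith

theorem card_transversals : (transversals ρ).card = ∏ i, (rolePart ρ i).card :=
  Fintype.card_piFinset _

theorem card_filter_rainbowEmb_add_lost_le :
    ((rainbowEmb χ).filter fun φ => ∀ a, ρ (φ a) = a).card + (lostTransversals χ ρ).card
      ≤ ∏ i, (rolePart ρ i).card := by
  rw [← card_transversals, ← card_union_of_disjoint]
  · refine card_le_card (union_subset ?_ (filter_subset _ _))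
    exact fun φ hφ => mem_transversals.2 (mem_filter.1 hφ).2
  · rw [Finset.disjoint_left]
    intro φ hφ hφ'
    obtain ⟨a, b, hab, hne⟩ := (mem_filter.1 hφ').2
    exact hne ((mem_rainbowEmb.1 (mem_filter.1 hφ).1).2 a b hab)

/-- A bad pair destroys all transversals through it. -/
theorem prod_card_rolePart_le_of_badPair {p : V × V} (hp : p ∈ badPairs χ ρ) :
    ∏ l ∈ (univ.erase (ρ p.1)).erase (ρ p.2), (rolePart ρ l).card
      ≤ ((lostTransversals χ ρ).filter fun φ =>
          φ (ρ p.1) = p.1 ∧ φ (ρ p.2) = p.2).card := by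
  obtain ⟨_, hne, hcol⟩ := mem_filter.1 hp
  calc ∏ l ∈ (univ.erase (ρ p.1)).erase (ρ p.2), (rolePart ρ l).card
      = (Fintype.piFinset fun l => if l = ρ p.1 then {p.1} else if l = ρ p.2 then {p.2} else
          rolePart ρ l).card := by
        rw [Fintype.card_piFinset, ← mul_prod_erase univ _ (mem_univ (ρ p.1)),
          ← mul_prod_erase (univ.erase (ρ p.1)) _ (mem_erase.2 ⟨hne.symm, mem_univ (ρ p.2)⟩)]
        simp only [if_true, card_singleton, one_mul, if_neg hne.symm]
        refine prod_congr rfl fun l hl => ?_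
        rw [if_neg (ne_of_mem_erase (mem_of_mem_erase hl)), if_neg (ne_of_mem_erase hl)]
    _ ≤ _ := by
        refine card_le_card fun φ hφ => ?_
        rw [Fintype.mem_piFinset] at hφ
        have h1 : φ (ρ p.1) = p.1 := by simpa using hφ (ρ p.1)
        have h2 : φ (ρ p.2) = p.2 := by simpa [hne.symm] using hφ (ρ p.2)
        refine mem_filter.2 ⟨mem_filter.2 ⟨mem_transversals.2 fun l => ?_, ρ p.1, ρ p.2, hne, ?_⟩,
          h1, h2⟩
        · have h := hφ l
          split_ifs at h with ha hb
          · rw [ha, h1]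
          · rw [hb, h2]
          · exact mem_rolePart.1 h
        · rw [h1, h2]; exact hcol

theorem sum_badPairs_le :
    ∑ p ∈ badPairs χ ρ, ((lostTransversals χ ρ).filter fun φ =>
        φ (ρ p.1) = p.1 ∧ φ (ρ p.2) = p.2).card
      ≤ (lostTransversals χ ρ).card * (k * k - k) := by
  have hswap := sum_card_bipartiteAbove_eq_sum_card_bipartiteBelow
    (s := badPairs χ ρ) (t := lostTransversals χ ρ)
    (fun p φ => φ (ρ p.1) = p.1 ∧ φ (ρ p.2) = p.2)
  simp only [bipartiteAbove, bipartiteBelow] at hswap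
  rw [hswap, ← smul_eq_mul, ← sum_const]
  refine sum_le_sum fun φ _ => ?_
  calc ((badPairs χ ρ).filter fun p => φ (ρ p.1) = p.1 ∧ φ (ρ p.2) = p.2).card
      ≤ (univ : Finset (Fin k)).offDiag.card := by
        refine card_le_card_of_injOn (fun p => (ρ p.1, ρ p.2)) ?_ ?_
        · intro p hp
          have hp := (mem_filter.1 (mem_filter.1 hp).1).2
          simpa using hp.1
        · intro p hp p' hp' h
          have hp := (mem_filter.1 hp).2
          have hp' := (mem_filter.1 hp').2
          obtain ⟨h1, h2⟩ := Prod.ext_iff.1 h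
          simp only at h1 h2
          exact Prod.ext (by rw [← hp.1, ← hp'.1, h1]) (by rw [← hp.2, ← hp'.2, h2])
    _ = k * k - k := by simp [offDiag_card]

end Counting

section UpperBound

variable {k : ℕ} {V : Type} [Fintype V] {χ : V → V → Finset (Fin k)} {ρ : V → Fin k}

theorem le_prod_card_rolePart (hk : 11 ≤ k) (hρ : ∀ x, IsRole χ x (ρ x))
    (hE : (Fintype.card V : ℝ) ^ k / (k : ℝ) ^ k ≤ (rainbowEmb χ).card) :
    19 / 25 * ((Fintype.card V : ℝ) ^ k / (k : ℝ) ^ k) ≤ ∏ i, ((rolePart ρ i).card : ℝ) := by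
  have hk' : (11 : ℝ) ≤ k := by exact_mod_cast hk
  have h1 := card_rainbowEmb_sub_le hk hρ
  have h2 : (((rainbowEmb χ).filter fun φ => ∀ a, ρ (φ a) = a).card : ℝ)
      ≤ ∏ i, ((rolePart ρ i).card : ℝ) := by
    exact_mod_cast (Nat.le_add_right _ _).trans
      (card_filter_rainbowEmb_add_lost_le (χ := χ) (ρ := ρ))
  have hη : (k : ℝ) ^ k * minorityDensity k * k ≤ 6 / 25 := by
    have h3 := minorityDensity_bound hk
    have h4 : 0 ≤ (k : ℝ) ^ k * minorityDensity k * k :=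
      mul_nonneg (mul_nonneg (by positivity) (minorityDensity_nonneg k)) (by positivity)
    nlinarith
  have h5 : k * (minorityDensity k * (Fintype.card V : ℝ) ^ k)
      ≤ 6 / 25 * ((Fintype.card V : ℝ) ^ k / (k : ℝ) ^ k) := by
    calc k * (minorityDensity k * (Fintype.card V : ℝ) ^ k)
        = ((k : ℝ) ^ k * minorityDensity k * k) *
            ((Fintype.card V : ℝ) ^ k / (k : ℝ) ^ k) := by
          field_simp
      _ ≤ _ := by gcongr
  linarith

theorem le_of_le_mul_mul_of_add_le {n K u v P : ℝ} {m : ℕ} (hm : 2 ≤ m) (hn : 0 < n)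
    (hu : 0 ≤ u) (hv : 0 ≤ v) (hP : 0 ≤ P) (hsum : u + v ≤ n)
    (h : 19 / 25 * (n ^ m / K) ≤ u * (v * P)) : 76 / 25 * (n ^ (m - 2) / K) ≤ P := by
  obtain ⟨l, rfl⟩ := Nat.exists_eq_add_of_le' hm
  rw [Nat.add_sub_cancel]
  have huv : u * v ≤ n ^ 2 / 4 := by nlinarith [sq_nonneg (u - v)]
  have h1 : u * (v * P) ≤ n ^ 2 / 4 * P := by
    rw [← mul_assoc]
    exact mul_le_mul_of_nonneg_right huv hP
  have h2 : 19 / 25 * (n ^ (l + 2) / K) = n ^ 2 / 4 * (76 / 25 * (n ^ l / K)) := by ring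
  rw [h2] at h
  exact le_of_mul_le_mul_left (h.trans h1) (by positivity)

theorem card_mixedEmb_le_card_lostTransversals (hk : 11 ≤ k)
    (hρ : ∀ x, IsRole χ x (ρ x)) (hV : 0 < Fintype.card V)
    (hE : (Fintype.card V : ℝ) ^ k / (k : ℝ) ^ k ≤ (rainbowEmb χ).card) :
    (mixedEmb χ ρ).card ≤ (lostTransversals χ ρ).card := by
  have hk' : (11 : ℝ) ≤ k := by exact_mod_cast hk
  obtain ⟨n, hn⟩ : ∃ n : ℝ, n = (Fintype.card V : ℝ) := ⟨_, rfl⟩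
  have hn0 : 0 < n := by rw [hn]; exact_mod_cast hV
  have hprod := le_prod_card_rolePart hk hρ hE
  have hmixed := card_mixedEmb_le hk hρ
  rw [← hn] at hprod hmixed
  have hlost : ∀ p ∈ badPairs χ ρ, 76 / 25 * (n ^ (k - 2) / (k : ℝ) ^ k)
      ≤ (((lostTransversals χ ρ).filter fun φ =>
          φ (ρ p.1) = p.1 ∧ φ (ρ p.2) = p.2).card : ℝ) := by
    intro p hp
    have hne : ρ p.1 ≠ ρ p.2 := (mem_filter.1 hp).2.1
    have h1 : (∏ l ∈ (univ.erase (ρ p.1)).erase (ρ p.2), ((rolePart ρ l).card : ℝ))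
        ≤ (((lostTransversals χ ρ).filter fun φ =>
          φ (ρ p.1) = p.1 ∧ φ (ρ p.2) = p.2).card : ℝ) := by
      exact_mod_cast prod_card_rolePart_le_of_badPair hp
    refine le_trans ?_ h1
    rw [← mul_prod_erase univ _ (mem_univ (ρ p.1)),
      ← mul_prod_erase (univ.erase (ρ p.1)) _ (mem_erase.2 ⟨hne.symm, mem_univ (ρ p.2)⟩)]
      at hprod
    have hsum : ((rolePart ρ (ρ p.1)).card : ℝ) + (rolePart ρ (ρ p.2)).card ≤ n := by
      have h := sum_le_sum_of_subset (f := fun i => (rolePart ρ i).card)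
        (subset_univ {ρ p.1, ρ p.2})
      rw [sum_pair hne, sum_card_rolePart] at h
      rw [hn]
      exact_mod_cast h
    exact le_of_le_mul_mul_of_add_le (by omega) hn0 (Nat.cast_nonneg _)
      (Nat.cast_nonneg _) (prod_nonneg fun _ _ => Nat.cast_nonneg _) hsum hprod
  have hsum : ((badPairs χ ρ).card : ℝ) * (76 / 25 * (n ^ (k - 2) / (k : ℝ) ^ k))
      ≤ (lostTransversals χ ρ).card * (k * (k - 1)) := by
    have h1 : (∑ p ∈ badPairs χ ρ, (((lostTransversals χ ρ).filter fun φ =>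
        φ (ρ p.1) = p.1 ∧ φ (ρ p.2) = p.2).card : ℝ))
        ≤ (lostTransversals χ ρ).card * (k * (k - 1)) := by
      have h2 := sum_badPairs_le (χ := χ) (ρ := ρ)
      have h3 : ((k * k - k : ℕ) : ℝ) = k * (k - 1) := by
        rw [Nat.cast_sub (Nat.le_mul_self k)]; push_cast; ring
      rw [← h3]
      exact_mod_cast h2
    refine le_trans ?_ h1
    rw [← nsmul_eq_mul, ← sum_const]
    exact sum_le_sum hlost
  have hη := minorityDensity_bound hk
  have hkk : (0 : ℝ) < k * (k - 1) := by nlinarith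
  have hle : ((mixedEmb χ ρ).card : ℝ) * (k * (k - 1))
      ≤ (lostTransversals χ ρ).card * (k * (k - 1)) := by
    calc ((mixedEmb χ ρ).card : ℝ) * (k * (k - 1))
        ≤ ((badPairs χ ρ).card * (minorityDensity k * n ^ (k - 2))) * (k * (k - 1)) := by gcongr
      _ = (badPairs χ ρ).card * (((k : ℝ) ^ k * minorityDensity k * (k * (k - 1)))
            * (n ^ (k - 2) / (k : ℝ) ^ k)) := by field_simp
      _ ≤ (badPairs χ ρ).card * (76 / 25 * (n ^ (k - 2) / (k : ℝ) ^ k)) := by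
          gcongr
          linarith
      _ ≤ _ := hsum
  exact_mod_cast le_of_mul_le_mul_right hle hkk

/-- If every vertex has a role, the role partition bounds the number of copies recursively. -/
theorem card_rainbowEmb_le_of_roles (hk : 11 ≤ k) (hsym : IsSym χ)
    (hρ : ∀ x, IsRole χ x (ρ x)) (hV : 0 < Fintype.card V)
    (hE : (Fintype.card V : ℝ) ^ k / (k : ℝ) ^ k ≤ (rainbowEmb χ).card) :
    (rainbowEmb χ).card
      ≤ ∏ i, (rolePart ρ i).card + ∑ i, maxRainbow k (rolePart ρ i).card := by
  have hsub : rainbowEmb χ ⊆ ((rainbowEmb χ).filter fun φ => ∀ a, ρ (φ a) = a) ∪ mixedEmb χ ρ ∪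
      univ.biUnion fun i => (rainbowEmb χ).filter fun φ => ∀ a, φ a ∈ rolePart ρ i := by
    intro φ hφ
    by_cases h1 : ∀ a, ρ (φ a) = a
    · exact mem_union_left _ (mem_union_left _ (mem_filter.2 ⟨hφ, h1⟩))
    by_cases h2 : ∃ i, ∀ a, φ a ∈ rolePart ρ i
    · obtain ⟨i, hi⟩ := h2
      exact mem_union_right _ (mem_biUnion.2 ⟨i, mem_univ _, mem_filter.2 ⟨hφ, hi⟩⟩)
    · exact mem_union_left _ (mem_union_right _ (mem_filter.2 ⟨hφ, h1, h2⟩))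
  have h1 := (card_le_card hsub).trans ((card_union_le _ _).trans
    (Nat.add_le_add (card_union_le _ _) card_biUnion_le))
  have h2 := card_filter_rainbowEmb_add_lost_le (χ := χ) (ρ := ρ)
  have h3 := card_mixedEmb_le_card_lostTransversals hk hρ hV hE
  have h4 : ∑ i, ((rainbowEmb χ).filter fun φ => ∀ a, φ a ∈ rolePart ρ i).card
      ≤ ∑ i, maxRainbow k (rolePart ρ i).card :=
    sum_le_sum fun i _ => card_rainbowEmb_filter_mem_le (by omega) hsym _
  omega

theorem sum_sum_card_through (χ : V → V → Finset (Fin k)) :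
    ∑ x, ∑ i, ((rainbowEmb χ).filter fun φ => φ i = x).card = k * (rainbowEmb χ).card := by
  rw [sum_comm]
  have : ∀ i : Fin k, ∑ x, ((rainbowEmb χ).filter fun φ => φ i = x).card
      = (rainbowEmb χ).card := fun i =>
    (card_eq_sum_card_fiberwise (f := fun φ : Fin k → V => φ i) (t := univ) (by simp)).symm
  simp [this]

/-- Deleting a vertex. -/
theorem card_rainbowEmb_le_through_add (hk : 3 ≤ k) (hsym : IsSym χ) (x : V) :
    (rainbowEmb χ).card ≤ ∑ i, ((rainbowEmb χ).filter fun φ => φ i = x).card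
      + maxRainbow k (Fintype.card V - 1) := by
  have hsub : rainbowEmb χ ⊆ (univ.biUnion fun i : Fin k =>
        (rainbowEmb χ).filter fun φ : Fin k → V => φ i = x) ∪
      (rainbowEmb χ).filter fun φ => ∀ a, φ a ∈ univ.erase x := by
    intro φ hφ
    by_cases h : ∃ i, φ i = x
    · obtain ⟨i, hi⟩ := h
      exact mem_union_left _ (mem_biUnion.2 ⟨i, mem_univ _, mem_filter.2 ⟨hφ, hi⟩⟩)
    · push Not at h
      exact mem_union_right _ (mem_filter.2 ⟨hφ, fun a => mem_erase.2 ⟨h a, mem_univ _⟩⟩)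
  have h1 := (card_le_card hsub).trans ((card_union_le _ _).trans
    (Nat.add_le_add_right card_biUnion_le _))
  have h2 := card_rainbowEmb_filter_mem_le hk hsym (univ.erase x)
  rw [card_erase_of_mem (mem_univ x), card_univ] at h2
  omega

/-- If deleting any vertex destroys many copies, the number of copies satisfies a recursive
bound. -/
theorem exists_partition_of_lt_card_rainbowEmb (hk : 11 ≤ k) (hsym : IsSym χ)
    (hV : 0 < Fintype.card V)
    (hbig : (maxRainbow k (Fintype.card V - 1) : ℝ) + ((Fintype.card V : ℝ) / k) ^ (k - 1)
      < (rainbowEmb χ).card) :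
    ∃ v : Fin k → ℕ, ∑ i, v i = Fintype.card V ∧ (∀ i, v i < Fintype.card V) ∧
      (rainbowEmb χ).card ≤ ∏ i, v i + ∑ i, maxRainbow k (v i) := by
  have hk' : (11 : ℝ) ≤ k := by exact_mod_cast hk
  have hdeg : ∀ x, ((Fintype.card V : ℝ) / k) ^ (k - 1)
      ≤ ∑ i, (((rainbowEmb χ).filter fun φ => φ i = x).card : ℝ) := by
    intro x
    have h := card_rainbowEmb_le_through_add (by omega) hsym x
    have h' : ((rainbowEmb χ).card : ℝ)
        ≤ ∑ i, (((rainbowEmb χ).filter fun φ => φ i = x).card : ℝ)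
        + maxRainbow k (Fintype.card V - 1) := by exact_mod_cast h
    linarith
  choose ρ hρ using fun x => exists_isRole hk x (hdeg x)
  have hE : (Fintype.card V : ℝ) ^ k / (k : ℝ) ^ k ≤ (rainbowEmb χ).card := by
    have h1 : ∑ x : V, ((Fintype.card V : ℝ) / k) ^ (k - 1) ≤ k * (rainbowEmb χ).card := by
      refine (sum_le_sum fun x _ => hdeg x).trans (le_of_eq ?_)
      exact_mod_cast sum_sum_card_through χ
    rw [sum_const, nsmul_eq_mul, card_univ] at h1
    rw [← div_pow]
    have h2 : ((Fintype.card V : ℝ) / k) ^ k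
        = (Fintype.card V / k) * ((Fintype.card V : ℝ) / k) ^ (k - 1) := by
      rw [← pow_succ', Nat.sub_add_cancel (by omega)]
    rw [h2, div_mul_eq_mul_div, div_le_iff₀ (by linarith)]
    linarith
  have hpos : 0 < ∏ i, (rolePart ρ i).card := by
    have : (0 : ℝ) < ∏ i, ((rolePart ρ i).card : ℝ) :=
      lt_of_lt_of_le (by positivity) (le_prod_card_rolePart hk hρ hE)
    exact_mod_cast this
  refine ⟨fun i => (rolePart ρ i).card, sum_card_rolePart, fun i => ?_,
    card_rainbowEmb_le_of_roles hk hsym hρ hV hE⟩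
  obtain ⟨j, hj⟩ : ∃ j : Fin k, j ≠ i := by
    have : Nontrivial (Fin k) := Fin.nontrivial_iff_two_le.2 (by omega)
    exact exists_ne i
  have hjpos : 0 < (rolePart ρ j).card :=
    Nat.pos_of_ne_zero (prod_ne_zero_iff.1 hpos.ne' j (mem_univ j))
  have h := sum_le_sum_of_subset (f := fun i => (rolePart ρ i).card) (subset_univ {j, i})
  rw [sum_pair hj, sum_card_rolePart] at h
  beta_reduce at h ⊢
  omega

/-- Either `I(R,n)` grows slowly at `n`, or it satisfies the recursive bound at `n`. -/
theorem maxRainbow_dichotomy (hk : 11 ≤ k) {n : ℕ} (hn : 0 < n) :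
    (maxRainbow k n : ℝ) ≤ maxRainbow k (n - 1) + ((n : ℝ) / k) ^ (k - 1) ∨
    ∃ v : Fin k → ℕ, ∑ i, v i = n ∧ (∀ i, v i < n) ∧
      maxRainbow k n ≤ ∏ i, v i + ∑ i, maxRainbow k (v i) := by
  obtain ⟨χ, hsym, hcard⟩ := exists_card_rainbowEmb_eq (k := k) (by omega) n
  rw [or_iff_not_imp_left, not_le]
  intro hbig
  have h := exists_partition_of_lt_card_rainbowEmb hk hsym (by simpa using hn)
    (by rw [hcard, Fintype.card_fin]; exact hbig)
  rwa [hcard, Fintype.card_fin] at h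

end UpperBound

section Asymptotics

variable {k : ℕ}

theorem maxRainbow_zero (hk : 3 ≤ k) : maxRainbow k 0 = 0 := by
  obtain ⟨χ, -, hcard⟩ := exists_card_rainbowEmb_eq hk 0
  rw [← hcard, card_eq_zero, eq_empty_iff_forall_notMem]
  exact fun φ _ => (φ ⟨0, by omega⟩).elim0

theorem pow_sub_self_pos (hk : 2 ≤ k) : (0 : ℝ) < (k : ℝ) ^ k - k := by
  have h : k < k ^ k := by
    calc k = k ^ 1 := (pow_one k).symm
      _ < k ^ k := Nat.pow_lt_pow_right (by omega) (by omega)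
  have : (k : ℝ) < (k : ℝ) ^ k := by exact_mod_cast h
  linarith

theorem exists_div_pow_le (hk : 2 ≤ k) : ∃ C : ℝ, ∀ n : ℕ, 0 < n →
    ((n : ℝ) / k) ^ (k - 1)
      ≤ ((n : ℝ) ^ k - ((n - 1 : ℕ) : ℝ) ^ k) / ((k : ℝ) ^ k - k) + C := by
  obtain ⟨m, rfl⟩ : ∃ m, k = m + 1 := ⟨k - 1, by omega⟩
  have hD := pow_sub_self_pos hk
  set K : ℝ := ((m + 1 : ℕ) : ℝ) with hK
  have hK2 : (2 : ℝ) ≤ K := by rw [hK]; exact_mod_cast hk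
  have hK0 : 0 < K := by linarith
  have hDeq : K ^ (m + 1) - K = K * (K ^ m - 1) := by ring
  have hm1 : 0 < K ^ m - 1 := by
    rw [hDeq] at hD
    exact (pos_iff_pos_of_mul_pos hD).1 hK0
  have hlim : Tendsto (fun n : ℕ => (1 - 1 / (n : ℝ)) ^ m) atTop (nhds 1) := by
    have := ((tendsto_const_nhds (x := (1 : ℝ))).sub tendsto_one_div_atTop_nhds_zero_nat).pow m
    simpa using this
  have hlt : (K ^ m - 1) / K ^ m < 1 := by
    rw [div_lt_one (by positivity)]; linarith
  obtain ⟨N, hN⟩ := eventually_atTop.1 (hlim.eventually_const_lt hlt)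
  refine ⟨(N : ℝ) ^ m, fun n hn => ?_⟩
  obtain ⟨l, rfl⟩ : ∃ l, n = l + 1 := ⟨n - 1, by omega⟩
  simp only [Nat.add_sub_cancel]
  have hn0 : (0 : ℝ) < ((l + 1 : ℕ) : ℝ) := by positivity
  have hbern : K * (l : ℝ) ^ m ≤ ((l + 1 : ℕ) : ℝ) ^ (m + 1) - (l : ℝ) ^ (m + 1) := by
    have h := (Commute.all ((l : ℝ) + 1) (l : ℝ)).geom_sum₂_mul (m + 1)
    rw [add_sub_cancel_left, mul_one] at h
    push_cast
    rw [← h, hK, ← nsmul_eq_mul, ← card_range (m + 1), ← sum_const, card_range]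
    refine sum_le_sum fun i hi => ?_
    have hi' : i ≤ m := by simpa [Nat.lt_succ_iff] using hi
    calc (l : ℝ) ^ m = (l : ℝ) ^ i * (l : ℝ) ^ (m + 1 - 1 - i) := by
          rw [← pow_add]; congr 1; omega
      _ ≤ ((l : ℝ) + 1) ^ i * (l : ℝ) ^ (m + 1 - 1 - i) := by gcongr; linarith
  by_cases hle : N ≤ l + 1
  · have h1 := (hN _ hle).le
    rw [div_le_iff₀ (by positivity)] at h1
    have h2 : (1 - 1 / ((l + 1 : ℕ) : ℝ)) * ((l + 1 : ℕ) : ℝ) = l := by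
      field_simp; push_cast; ring
    have h3 : (((l + 1 : ℕ) : ℝ) / K) ^ m * (K * (K ^ m - 1)) ≤ K * (l : ℝ) ^ m := by
      rw [← h2, mul_pow, div_pow, div_mul_eq_mul_div, div_le_iff₀ (by positivity)]
      calc ((l + 1 : ℕ) : ℝ) ^ m * (K * (K ^ m - 1))
          ≤ ((l + 1 : ℕ) : ℝ) ^ m * (K * ((1 - 1 / ((l + 1 : ℕ) : ℝ)) ^ m * K ^ m)) := by gcongr
        _ = _ := by ring
    have h4 : (((l + 1 : ℕ) : ℝ) / K) ^ m
        ≤ (((l + 1 : ℕ) : ℝ) ^ (m + 1) - (l : ℝ) ^ (m + 1)) / (K ^ (m + 1) - K) := by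
      rw [le_div_iff₀ hD, hDeq]
      exact h3.trans hbern
    have : (0 : ℝ) ≤ (N : ℝ) ^ m := by positivity
    linarith
  · have h1 : (((l + 1 : ℕ) : ℝ) / K) ^ m ≤ (N : ℝ) ^ m := by
      have h2 : ((l + 1 : ℕ) : ℝ) ≤ N := by exact_mod_cast (by omega : l + 1 ≤ N)
      have h3 : ((l + 1 : ℕ) : ℝ) / K ≤ N :=
        (div_le_self hn0.le (by linarith)).trans h2
      gcongr
    have h2 : 0 ≤ (((l + 1 : ℕ) : ℝ) ^ (m + 1) - (l : ℝ) ^ (m + 1)) / (K ^ (m + 1) - K) :=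
      div_nonneg (le_trans (by positivity) hbern) hD.le
    linarith

theorem exists_maxRainbow_le (hk : 11 ≤ k) : ∃ C : ℝ, ∀ n : ℕ,
    (maxRainbow k n : ℝ) ≤ (n : ℝ) ^ k / ((k : ℝ) ^ k - k) + C * n := by
  obtain ⟨C, hC⟩ := exists_div_pow_le (k := k) (by omega)
  have hD := pow_sub_self_pos (k := k) (by omega)
  refine ⟨C, fun n => ?_⟩
  induction n using Nat.strong_induction_on with
  | _ n ih =>
    rcases Nat.eq_zero_or_pos n with rfl | hn
    · simp [maxRainbow_zero (k := k) (by omega), show k ≠ 0 by omega]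
    rcases maxRainbow_dichotomy hk hn with h | ⟨v, hsum, hlt, h⟩
    · have h1 := ih (n - 1) (by omega)
      have h2 := hC n hn
      rw [sub_div] at h2
      have h3 : ((n - 1 : ℕ) : ℝ) = n - 1 := by rw [Nat.cast_sub hn]; simp
      have h4 : C * ((n - 1 : ℕ) : ℝ) = C * n - C := by rw [h3]; ring
      linarith
    · have h1 : (maxRainbow k n : ℝ) ≤ ∏ i, (v i : ℝ) + ∑ i, (maxRainbow k (v i) : ℝ) := by
        exact_mod_cast h
      have h2 : ∑ i, (maxRainbow k (v i) : ℝ)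
          ≤ (∑ i, (v i : ℝ) ^ k) / ((k : ℝ) ^ k - k) + C * n := by
        refine (sum_le_sum fun i _ => ih (v i) (hlt i)).trans (le_of_eq ?_)
        rw [sum_add_distrib, ← sum_div, ← mul_sum, ← hsum]
        push_cast
        rfl
      have h3 := mul_prod_add_sum_pow_le (k := k) (by omega) (fun i => (v i : ℝ))
        (fun i => Nat.cast_nonneg _)
      have h4 : ∑ i, (v i : ℝ) = n := by exact_mod_cast hsum
      rw [h4] at h3
      have h5 : ∏ i, (v i : ℝ) + (∑ i, (v i : ℝ) ^ k) / ((k : ℝ) ^ k - k)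
          ≤ (n : ℝ) ^ k / ((k : ℝ) ^ k - k) := by
        rw [le_div_iff₀ hD, add_mul, div_mul_cancel₀ _ hD.ne']
        linarith
      linarith

theorem sub_pow_ge (hk : 1 ≤ k) {n : ℝ} (hn : (k : ℝ) ≤ n) :
    n ^ k - (k : ℝ) ^ 2 * n ^ (k - 1) ≤ (n - k) ^ k := by
  obtain ⟨m, rfl⟩ : ∃ m, k = m + 1 := ⟨k - 1, by omega⟩
  set K : ℝ := ((m + 1 : ℕ) : ℝ) with hK
  have hK0 : 0 < K := by rw [hK]; positivity
  have hn0 : 0 < n := by linarith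
  have h := one_add_mul_le_pow (a := -(K / n)) (by
    have : K / n ≤ 1 := (div_le_one hn0).2 hn
    linarith) (m + 1)
  have h1 : (n - K) ^ (m + 1) = n ^ (m + 1) * (1 + -(K / n)) ^ (m + 1) := by
    rw [← mul_pow]; congr 1; field_simp; ring
  rw [h1, Nat.add_sub_cancel]
  calc n ^ (m + 1) - K ^ 2 * n ^ m = n ^ (m + 1) * (1 + K * -(K / n)) := by
        field_simp; ring
    _ ≤ _ := by gcongr

theorem le_maxRainbow (hk : 3 ≤ k) (n : ℕ) :
    (n : ℝ) ^ k / ((k : ℝ) ^ k - k) - 2 * (k : ℝ) ^ 2 / ((k : ℝ) ^ k - k) * (n : ℝ) ^ (k - 1)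
      ≤ maxRainbow k n := by
  have hD := pow_sub_self_pos (k := k) (by omega)
  have hk' : (3 : ℝ) ≤ k := by exact_mod_cast hk
  obtain ⟨D, hDdef⟩ : ∃ D : ℝ, D = (k : ℝ) ^ k - k := ⟨_, rfl⟩
  rw [← hDdef] at hD ⊢
  induction n using Nat.strong_induction_on with
  | _ n ih =>
    have hnk : (n : ℝ) ^ k = n * (n : ℝ) ^ (k - 1) := by
      rw [← pow_succ', Nat.sub_add_cancel (by omega)]
    rcases lt_or_ge n k with hlt | hge
    · have h1 : (n : ℝ) ≤ 2 * (k : ℝ) ^ 2 := by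
        have : (n : ℝ) ≤ k := by exact_mod_cast hlt.le
        nlinarith
      have h2 : (n : ℝ) ^ k / D ≤ 2 * (k : ℝ) ^ 2 / D * (n : ℝ) ^ (k - 1) := by
        rw [hnk, mul_div_right_comm]
        gcongr
      have h3 : (0 : ℝ) ≤ maxRainbow k n := Nat.cast_nonneg _
      linarith
    · have hm : k * (n / k) ≤ n := Nat.mul_div_le n k
      have hmlt : n / k < n := Nat.div_lt_self (by omega) (by omega)
      have hrec : (((n / k : ℕ) : ℝ)) ^ k + k * maxRainbow k (n / k) ≤ maxRainbow k n := by
        exact_mod_cast pow_add_mul_maxRainbow_le hk hm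
      have hih := ih (n / k) hmlt
      obtain ⟨m, hmdef⟩ : ∃ m : ℝ, m = ((n / k : ℕ) : ℝ) := ⟨_, rfl⟩
      rw [← hmdef] at hrec hih
      have hm0 : 0 ≤ m := by rw [hmdef]; positivity
      have hle : (k : ℝ) * m ≤ n := by rw [hmdef]; exact_mod_cast hm
      have hge' : (n : ℝ) - k ≤ k * m := by
        have h : n ≤ k * (n / k) + k := by
          have := Nat.div_add_mod n k
          have := Nat.mod_lt n (show k > 0 by omega)
          omega
        have : (n : ℝ) ≤ k * m + k := by rw [hmdef]; exact_mod_cast h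
        linarith
      have hknR : (k : ℝ) ≤ n := by exact_mod_cast hge
      have h1 : (n : ℝ) ^ k - (k : ℝ) ^ 2 * (n : ℝ) ^ (k - 1) ≤ (k : ℝ) ^ k * m ^ k := by
        rw [← mul_pow]
        exact (sub_pow_ge (by omega) hknR).trans (pow_le_pow_left₀ (by linarith) hge' k)
      have h2 : 2 * k * m ^ (k - 1) ≤ (n : ℝ) ^ (k - 1) := by
        calc 2 * k * m ^ (k - 1) ≤ (k : ℝ) ^ (k - 1) * m ^ (k - 1) := by
              gcongr
              calc (2 : ℝ) * k ≤ (k : ℝ) ^ 2 := by nlinarith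
                _ ≤ (k : ℝ) ^ (k - 1) := pow_le_pow_right₀ (by linarith) (by omega)
          _ = (k * m) ^ (k - 1) := (mul_pow _ _ _).symm
          _ ≤ _ := by gcongr
      refine le_trans ?_ hrec
      refine le_trans ?_ (add_le_add_right (mul_le_mul_of_nonneg_left hih (by linarith)) _)
      have h3 : m ^ k + k * (m ^ k / D - 2 * (k : ℝ) ^ 2 / D * m ^ (k - 1))
          = ((k : ℝ) ^ k * m ^ k - (k : ℝ) ^ 2 * (2 * k * m ^ (k - 1))) / D := by
        have : (k : ℝ) ^ k = D + k := by rw [hDdef]; ring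
        rw [this]
        field_simp
        ring
      rw [h3, div_mul_eq_mul_div, ← sub_div]
      refine div_le_div_of_nonneg_right ?_ hD.le
      have h4 := mul_le_mul_of_nonneg_left h2 (by positivity : (0 : ℝ) ≤ (k : ℝ) ^ 2)
      linarith

theorem tendsto_maxRainbow_div_pow (hk : 11 ≤ k) :
    Tendsto (fun n : ℕ => (maxRainbow k n : ℝ) / (n : ℝ) ^ k) atTop
      (nhds (1 / ((k : ℝ) ^ k - k))) := by
  obtain ⟨C, hC⟩ := exists_maxRainbow_le hk
  obtain ⟨D, hD⟩ : ∃ D : ℝ, D = (k : ℝ) ^ k - k := ⟨_, rfl⟩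
  have hlow := le_maxRainbow (k := k) (by omega)
  rw [← hD]
  simp only [← hD] at hC hlow
  have hpow : ∀ n : ℕ, (n : ℝ) ^ k = n * (n : ℝ) ^ (k - 1) := fun n => by
    rw [← pow_succ', Nat.sub_add_cancel (by omega)]
  have hinv : Tendsto (fun n : ℕ => ((n : ℝ))⁻¹) atTop (nhds 0) :=
    tendsto_inv_atTop_nhds_zero_nat
  have hl : Tendsto (fun n : ℕ => 1 / D - 2 * (k : ℝ) ^ 2 / D * ((n : ℝ))⁻¹) atTop
      (nhds (1 / D)) := by
    simpa using (tendsto_const_nhds (x := 1 / D)).sub (hinv.const_mul (2 * (k : ℝ) ^ 2 / D))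
  have hu : Tendsto (fun n : ℕ => 1 / D + C * ((n : ℝ))⁻¹ ^ (k - 1)) atTop (nhds (1 / D)) := by
    simpa [show k - 1 ≠ 0 by omega] using
      (tendsto_const_nhds (x := 1 / D)).add ((hinv.pow (k - 1)).const_mul C)
  refine tendsto_of_tendsto_of_tendsto_of_le_of_le' hl hu ?_ ?_
  · filter_upwards [eventually_gt_atTop 0] with n hn
    have hn' : (0 : ℝ) < n := by exact_mod_cast hn
    rw [le_div_iff₀ (by positivity)]
    refine le_trans (le_of_eq ?_) (hlow n)
    rw [sub_mul, hpow]
    field_simp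
  · filter_upwards [eventually_gt_atTop 0] with n hn
    have hn' : (0 : ℝ) < n := by exact_mod_cast hn
    rw [div_le_iff₀ (by positivity)]
    refine (hC n).trans (le_of_eq ?_)
    rw [add_mul, hpow, inv_pow]
    field_simp

theorem tendsto_pow_div_choose (k : ℕ) :
    Tendsto (fun n : ℕ => (n : ℝ) ^ k / (n.choose k : ℝ)) atTop (nhds (k.factorial : ℝ)) := by
  have h := (Asymptotics.isEquivalent_iff_tendsto_one ?_).1 (isEquivalent_choose k).symm
  · refine (h.mul_const (k.factorial : ℝ)).congr' ?_ |>.trans (by simp)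
    filter_upwards with n
    have : (k.factorial : ℝ) ≠ 0 := by positivity
    simp only [Pi.div_apply]
    field_simp
  · filter_upwards [eventually_ge_atTop k] with n hn
    have := Nat.choose_pos hn
    positivity

end Asymptotics

/-- For `k ≥ 11`, `I(R,n)/binom(n,k)` converges to `k!/(k^k − k)` where `R`
is the rainbow `k`-clique. -/
theorem rainbow_clique_inducibility (k : ℕ) (hk : 11 ≤ k) :
    Filter.Tendsto
      (fun n : ℕ => (maxCopyCount k n (rainbowClique k) : ℝ) / (n.choose k : ℝ))
      Filter.atTop (nhds ((k.factorial : ℝ) / ((k : ℝ) ^ k - k))) := by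
  have h := (tendsto_maxRainbow_div_pow hk).mul (tendsto_pow_div_choose k)
  rw [one_div_mul_eq_div] at h
  refine h.congr' ?_
  filter_upwards [eventually_gt_atTop 0] with n hn
  have hn' : (n : ℝ) ^ k ≠ 0 := by positivity
  exact div_mul_div_cancel₀ hn'
end

section
/- Let k ≥ 11, let R be the rainbow k-clique, and let H be an n-vertex T-edge-colored complete graph such that (i) every vertex x ∈ V(H) satisfies d(x) ≥ n^{k−1}/(k^{k−1}−1), (ii) I(R,H) ≥ (k!/(k^k−k))·binom(n,k), and (iii) n^k ≤ 1.01·n(n−1)⋯(n−k+1). Then for every i ∈ [k], the number of vertices x ∈ V(H) with |N_i(x)| ≥ |N_j(x)| for all j ∈ [k] is at most (1 − 1/(3k))·n. -/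
open Finset Filter

open scoped Classical

/-- The AM-GM inequality for a finite family of natural numbers with sum at most `m`. -/
lemma prod_le_div_card_pow {ι : Type*} (s : Finset ι) (hs : s.Nonempty) (f : ι → ℕ) (m : ℕ)
    (hm : ∑ l ∈ s, f l ≤ m) :
    (∏ l ∈ s, (f l : ℝ)) ≤ ((m : ℝ) / (#s : ℝ)) ^ #s := by
  have hc : (0 : ℝ) < #s := by exact_mod_cast hs.card_pos
  have hf : ∀ l ∈ s, (0 : ℝ) ≤ f l := fun l _ => Nat.cast_nonneg _
  have hamgm := Real.geom_mean_le_arith_mean s (fun _ => (1 : ℝ)) (fun l => (f l : ℝ))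
    (fun _ _ => zero_le_one) (by simpa using hc) hf
  simp only [Real.rpow_one, sum_const, nsmul_eq_mul, mul_one, one_mul] at hamgm
  have hpos : (0 : ℝ) ≤ ∏ l ∈ s, (f l : ℝ) := prod_nonneg hf
  calc (∏ l ∈ s, (f l : ℝ)) = ((∏ l ∈ s, (f l : ℝ)) ^ ((#s : ℝ)⁻¹)) ^ #s :=
        (Real.rpow_inv_natCast_pow hpos hs.card_pos.ne').symm
    _ ≤ ((∑ l ∈ s, (f l : ℝ)) / #s) ^ #s :=
        pow_le_pow_left₀ (Real.rpow_nonneg hpos _) hamgm _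
    _ ≤ ((m : ℝ) / #s) ^ #s := by
        have : (∑ l ∈ s, (f l : ℝ)) ≤ m := by exact_mod_cast hm
        gcongr

/-- Every copy of `R` is the image of an embedding, and each embedding sends `j` to some vertex. -/
lemma copyCount_le_sum_embCount {T : Type} (k n : ℕ) (R : Fin k → Fin k → T)
    (χ : Fin n → Fin n → T) (j : Fin k) :
    copyCount k n R χ ≤ ∑ x, embCount k n R χ j x := by
  have hsub : (powersetCard k (univ : Finset (Fin n))).filter
      (fun S => ∃ φ : Fin k → Fin n, Function.Injective φ ∧ (∀ a, φ a ∈ S) ∧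
        ∀ a b : Fin k, a ≠ b → χ (φ a) (φ b) = R a b) ⊆
      (univ.biUnion fun x => (univ : Finset (Fin k → Fin n)).filter
        (fun φ => Function.Injective φ ∧ φ j = x ∧
          ∀ a b : Fin k, a ≠ b → χ (φ a) (φ b) = R a b)).image (fun φ => univ.image φ) := by
    intro S hS
    obtain ⟨hcard, φ, hinj, hmem, hcol⟩ := mem_filter.1 hS
    refine mem_image.2 ⟨φ, ?_, ?_⟩
    · simpa using ⟨hinj, hcol⟩
    · refine eq_of_subset_of_card_le (image_subset_iff.2 fun a _ => hmem a) ?_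
      rw [card_image_of_injective _ hinj, (mem_powersetCard.1 hcard).2, card_univ,
        Fintype.card_fin]
  exact (card_le_card hsub).trans (card_image_le.trans card_biUnion_le)

lemma embCount_le_card {T : Type} {k n : ℕ} {R : Fin k → Fin k → T} {χ : Fin n → Fin n → T}
    {j : Fin k} {x : Fin n} {P : Finset (Fin k → Fin n)}
    (hP : ∀ φ : Fin k → Fin n, (Function.Injective φ ∧ φ j = x ∧
      ∀ a b : Fin k, a ≠ b → χ (φ a) (φ b) = R a b) → φ ∈ P) :
    embCount k n R χ j x ≤ #P :=
  card_le_card fun φ hφ => hP φ (mem_filter.1 hφ).2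

lemma mem_Nset {T : Type} {k n : ℕ} {R : Fin k → Fin k → T} {χ : Fin n → Fin n → T} {i : Fin k}
    {x y : Fin n} : y ∈ Nset k n R χ i x ↔
      y ≠ x ∧ ∃ φ : Fin k → Fin n, Function.Injective φ ∧ φ i = x ∧
        (∀ a b : Fin k, a ≠ b → χ (φ a) (φ b) = R a b) ∧ ∃ a, φ a = y := by
  rw [Nset, mem_filter]
  exact and_iff_right (mem_univ y)

/-- The part of `N_j(x)` joined to `x` by the color `{j, l}`. -/
noncomputable def colorPart (k n : ℕ) (χ : Fin n → Fin n → Finset (Fin k)) (j : Fin k) (x : Fin n)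
    (l : Fin k) : Finset (Fin n) :=
  (Nset k n (rainbowClique k) χ j x).filter (fun y => χ x y = {j, l})

lemma mem_colorPart {k n : ℕ} {χ : Fin n → Fin n → Finset (Fin k)} {j l : Fin k} {x y : Fin n} :
    y ∈ colorPart k n χ j x l ↔ y ∈ Nset k n (rainbowClique k) χ j x ∧ χ x y = {j, l} := by
  rw [colorPart, mem_filter]

lemma embCount_le_prod_colorPart (k n : ℕ) (χ : Fin n → Fin n → Finset (Fin k)) (j : Fin k)
    (x : Fin n) :
    embCount k n (rainbowClique k) χ j x ≤ ∏ l ∈ univ.erase j, #(colorPart k n χ j x l) := by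
  have hmem : ∀ φ : Fin k → Fin n, (Function.Injective φ ∧ φ j = x ∧
        ∀ a b : Fin k, a ≠ b → χ (φ a) (φ b) = rainbowClique k a b) →
      φ ∈ Fintype.piFinset (fun l => if l = j then {x} else colorPart k n χ j x l) := by
    rintro φ ⟨hinj, hx, hcol⟩
    refine Fintype.mem_piFinset.2 fun l => ?_
    by_cases hl : l = j
    · simp [hl, hx]
    · rw [if_neg hl]
      refine mem_colorPart.2 ⟨mem_Nset.2 ⟨?_, φ, hinj, hx, hcol, l, rfl⟩, ?_⟩
      · rw [← hx]
        exact fun h => hl (hinj h)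
      · rw [← hx]
        exact hcol j l (Ne.symm hl)
  refine (embCount_le_card hmem).trans ?_
  rw [Fintype.card_piFinset, ← mul_prod_erase univ _ (mem_univ j)]
  simp only [if_true, card_singleton, one_mul]
  refine (prod_congr rfl fun l hl => ?_).le
  rw [if_neg (ne_of_mem_erase hl)]

lemma pair_right_injective_of_ne {α : Type*} [DecidableEq α] {j l m : α} (hl : l ≠ j)
    (h : ({j, l} : Finset α) = {j, m}) : l = m := by
  have : l ∈ ({j, m} : Finset α) := h ▸ (by simp)
  simpa [hl] using this

lemma colorPart_pairwiseDisjoint (k n : ℕ) (χ : Fin n → Fin n → Finset (Fin k)) (j : Fin k)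
    (x : Fin n) :
    ((univ.erase j : Finset (Fin k)) : Set (Fin k)).PairwiseDisjoint (colorPart k n χ j x) := by
  intro l hl m _ hlm
  refine disjoint_left.2 fun y hy hy' => hlm ?_
  exact pair_right_injective_of_ne (ne_of_mem_erase (mem_coe.1 hl))
    ((mem_colorPart.1 hy).2.symm.trans (mem_colorPart.1 hy').2)

lemma sum_card_colorPart_le (k n : ℕ) (χ : Fin n → Fin n → Finset (Fin k)) (j : Fin k)
    (x : Fin n) :
    ∑ l ∈ univ.erase j, #(colorPart k n χ j x l) ≤ #(Nset k n (rainbowClique k) χ j x) := by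
  rw [← card_biUnion (colorPart_pairwiseDisjoint k n χ j x)]
  exact card_le_card (biUnion_subset.2 fun l _ => filter_subset _ _)

/-- The color joining `x` to a vertex of `N_i(x)` contains `i`. -/
lemma mem_color_of_mem_Nset {k n : ℕ} {χ : Fin n → Fin n → Finset (Fin k)} {i : Fin k}
    {x y : Fin n} (hy : y ∈ Nset k n (rainbowClique k) χ i x) : i ∈ χ x y := by
  obtain ⟨hne, φ, -, hx, hcol, a, rfl⟩ := mem_Nset.1 hy
  have hia : i ≠ a := by
    rintro rfl
    exact hne hx
  rw [← hx, hcol i a hia]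
  simp [rainbowClique]

lemma embCount_le_div_pow (k n : ℕ) (hk : 2 ≤ k) (χ : Fin n → Fin n → Finset (Fin k))
    (j : Fin k) (x : Fin n) :
    (embCount k n (rainbowClique k) χ j x : ℝ) ≤ ((n : ℝ) / ((k - 1 : ℕ) : ℝ)) ^ (k - 1) := by
  have hcard : #(univ.erase j : Finset (Fin k)) = k - 1 := by simp
  have hN : #(Nset k n (rainbowClique k) χ j x) ≤ n := by
    simpa using card_le_univ (Nset k n (rainbowClique k) χ j x)
  have hprod := prod_le_div_card_pow (univ.erase j) (card_pos.1 (by omega))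
    (fun l => #(colorPart k n χ j x l)) n ((sum_card_colorPart_le k n χ j x).trans hN)
  rw [hcard] at hprod
  refine le_trans ?_ hprod
  exact_mod_cast embCount_le_prod_colorPart k n χ j x

/-- If `|N_j(x)| ≤ |N_i(x)|` then few embeddings send `j` to `x`, as the part of `N_j(x)` outside
color `{i, j}` has a disjoint counterpart in `N_i(x)` of at least the same size. -/
lemma two_pow_mul_embCount_le_div_pow (k n : ℕ) (hk : 2 ≤ k)
    (χ : Fin n → Fin n → Finset (Fin k)) {i j : Fin k} (hij : i ≠ j) (x : Fin n)
    (hle : #(Nset k n (rainbowClique k) χ j x) ≤ #(Nset k n (rainbowClique k) χ i x)) :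
    (2 : ℝ) ^ (k - 2) * (embCount k n (rainbowClique k) χ j x : ℝ) ≤
      ((n : ℝ) / ((k - 1 : ℕ) : ℝ)) ^ (k - 1) := by
  have hcard : #(univ.erase j : Finset (Fin k)) = k - 1 := by simp
  have hi : i ∈ univ.erase j := mem_erase.2 ⟨hij, mem_univ i⟩
  have hcard' : #((univ.erase j).erase i : Finset (Fin k)) = k - 2 := by
    rw [card_erase_of_mem hi, hcard]
    omega
  set B := ((univ.erase j).erase i).biUnion (colorPart k n χ j x)
  have hBcard : #B = ∑ l ∈ (univ.erase j).erase i, #(colorPart k n χ j x l) :=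
    card_biUnion ((colorPart_pairwiseDisjoint k n χ j x).subset
      (coe_subset.2 (erase_subset _ _)))
  have hdisj : Disjoint (Nset k n (rainbowClique k) χ i x) B := by
    refine disjoint_left.2 fun y hy hyB => ?_
    obtain ⟨l, hl, hyl⟩ := mem_biUnion.1 hyB
    have hmem := mem_color_of_mem_Nset hy
    rw [(mem_colorPart.1 hyl).2, mem_insert, mem_singleton] at hmem
    exact hmem.elim hij (ne_of_mem_erase hl).symm
  have htotal : #(Nset k n (rainbowClique k) χ i x) + #B ≤ n := by
    rw [← card_union_of_disjoint hdisj]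
    simpa using card_le_univ (Nset k n (rainbowClique k) χ i x ∪ B)
  have hsplit := sum_card_colorPart_le k n χ j x
  rw [← add_sum_erase _ _ hi, ← hBcard] at hsplit
  let w : Fin k → ℕ := fun l => (if l = i then 1 else 2) * #(colorPart k n χ j x l)
  have hw : ∀ l ∈ (univ.erase j).erase i, w l = 2 * #(colorPart k n χ j x l) := fun l hl => by
    simp [w, ne_of_mem_erase hl]
  have hwi : w i = #(colorPart k n χ j x i) := by simp [w]
  have hsum : ∑ l ∈ univ.erase j, w l ≤ n := by
    rw [← add_sum_erase _ _ hi, sum_congr rfl hw, ← mul_sum, ← hBcard, hwi]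
    omega
  have hprod : ∏ l ∈ univ.erase j, w l =
      2 ^ (k - 2) * ∏ l ∈ univ.erase j, #(colorPart k n χ j x l) := by
    rw [← mul_prod_erase _ _ hi, prod_congr rfl hw, prod_mul_distrib, prod_const, hcard', hwi,
      ← mul_prod_erase _ (fun l => #(colorPart k n χ j x l)) hi]
    ring
  have hamgm := prod_le_div_card_pow (univ.erase j) ⟨i, hi⟩ w n hsum
  rw [hcard] at hamgm
  refine le_trans ?_ hamgm
  have hnat := Nat.mul_le_mul_left (2 ^ (k - 2)) (embCount_le_prod_colorPart k n χ j x)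
  rw [← hprod] at hnat
  exact_mod_cast hnat

lemma mul_le_eleven_mul_two_pow (k : ℕ) (hk : 11 ≤ k) : 512 * k ≤ 11 * 2 ^ (k - 2) := by
  induction k, hk using Nat.le_induction with
  | base => norm_num
  | succ m hm ih =>
    rw [show m + 1 - 2 = (m - 2) + 1 by omega, pow_succ]
    omega

/-- The numerical inequality `1.01 · (k/(k-1))^(k-1) · (k/2^(k-2) + 1/3) < 1` in cleared form. -/
lemma rainbow_numeric (k : ℕ) (hk : 11 ≤ k) :
    1.01 * (k : ℝ) ^ k * (1 / 2 ^ (k - 2) + 1 / (3 * (k : ℝ))) <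
      ((k - 1 : ℕ) : ℝ) ^ (k - 1) := by
  obtain ⟨m, rfl⟩ : ∃ m, k = m + 1 := ⟨k - 1, by omega⟩
  have hm : (0 : ℝ) < m := by
    have : 0 < m := by omega
    exact_mod_cast this
  have hk0 : (0 : ℝ) < ((m + 1 : ℕ) : ℝ) := by positivity
  have hexp : ((m + 1 : ℕ) : ℝ) ^ m ≤ 2.7183 * (m : ℝ) ^ m := by
    have h1 : (((m + 1 : ℕ) : ℝ) / m) ^ m ≤ Real.exp 1 := by
      have h := Real.add_one_le_exp ((1 : ℝ) / m)
      calc (((m + 1 : ℕ) : ℝ) / m) ^ m ≤ Real.exp (1 / m) ^ m := by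
            refine pow_le_pow_left₀ (by positivity) ?_ _
            refine le_trans (le_of_eq ?_) h
            push_cast
            field_simp
            ring
        _ = Real.exp 1 := by
            rw [← Real.exp_nat_mul]
            congr 1
            field_simp
    have h2 : Real.exp 1 ≤ 2.7183 := by
      have := Real.exp_one_lt_d9
      linarith
    rw [div_pow, div_le_iff₀ (by positivity)] at h1
    exact h1.trans (by gcongr)
  have hpow : ((m + 1 : ℕ) : ℝ) * (1 / 2 ^ (m + 1 - 2)) ≤ 11 / 512 := by
    have h : (512 : ℝ) * ((m + 1 : ℕ) : ℝ) ≤ 11 * 2 ^ (m + 1 - 2) := by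
      exact_mod_cast mul_le_eleven_mul_two_pow (m + 1) hk
    rw [mul_one_div, div_le_div_iff₀ (by positivity) (by norm_num)]
    linarith
  have hthird : ((m + 1 : ℕ) : ℝ) * (1 / (3 * ((m + 1 : ℕ) : ℝ))) = 1 / 3 := by
    field_simp
  rw [Nat.add_sub_cancel]
  have hmm : (0 : ℝ) < (m : ℝ) ^ m := by positivity
  calc 1.01 * ((m + 1 : ℕ) : ℝ) ^ (m + 1) *
        (1 / 2 ^ (m + 1 - 2) + 1 / (3 * ((m + 1 : ℕ) : ℝ)))
      = 1.01 * ((m + 1 : ℕ) : ℝ) ^ m * (((m + 1 : ℕ) : ℝ) * (1 / 2 ^ (m + 1 - 2)) +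
          ((m + 1 : ℕ) : ℝ) * (1 / (3 * ((m + 1 : ℕ) : ℝ)))) := by
        rw [pow_succ]
        ring
    _ ≤ 1.01 * (2.7183 * (m : ℝ) ^ m) * (11 / 512 + 1 / 3) := by
        rw [hthird]
        gcongr
    _ < (m : ℝ) ^ m := by nlinarith

/-- no part is too large, for the rainbow `k`-clique, `k ≥ 11`: under the stated
hypotheses, for each `i` the number of vertices whose largest neighborhood is `N_i` is at most
`(1 − 1/(3k))·n`. -/
theorem one_large_part (k n : ℕ) (hk : 11 ≤ k)
    (χ : Fin n → Fin n → Finset (Fin k)) (hχ : IsSym χ)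
    (hdeg : ∀ x : Fin n,
      (n : ℝ) ^ (k - 1) / ((k : ℝ) ^ (k - 1) - 1) ≤ (vertDeg k n (rainbowClique k) χ x : ℝ))
    (hcount : ((k.factorial : ℝ) / ((k : ℝ) ^ k - k)) * (n.choose k : ℝ) ≤
      (copyCount k n (rainbowClique k) χ : ℝ))
    (hfall : (n : ℝ) ^ k ≤ 1.01 * (n.descFactorial k : ℝ)) :
    ∀ i : Fin k,
      ((((Finset.univ : Finset (Fin n)).filter (fun x => ∀ j : Fin k,
          (Nset k n (rainbowClique k) χ j x).card ≤
            (Nset k n (rainbowClique k) χ i x).card)).card : ℝ)) ≤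
        (1 - 1 / (3 * (k : ℝ))) * (n : ℝ) := by
  intro i
  rcases Nat.eq_zero_or_pos n with rfl | hn
  · simp
  set A := (univ : Finset (Fin n)).filter (fun x => ∀ j : Fin k,
    #(Nset k n (rainbowClique k) χ j x) ≤ #(Nset k n (rainbowClique k) χ i x))
  by_contra! hlarge
  have : Nontrivial (Fin k) := Fin.nontrivial_iff_two_le.2 (by omega)
  obtain ⟨j, hji⟩ := exists_ne i
  have hn0 : (0 : ℝ) < n := by exact_mod_cast hn
  have hk0 : (0 : ℝ) < k := by
    have : 0 < k := by omega
    exact_mod_cast this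
  have hk1 : (0 : ℝ) < ((k - 1 : ℕ) : ℝ) := by
    have : 0 < k - 1 := by omega
    exact_mod_cast this
  set M : ℝ := ((n : ℝ) / ((k - 1 : ℕ) : ℝ)) ^ (k - 1) with hM
  have hM0 : 0 < M := by positivity
  have hcompl : (#Aᶜ : ℝ) ≤ n / (3 * (k : ℝ)) := by
    have h : (#A : ℝ) + #Aᶜ = n := by
      have := card_add_card_compl A
      rw [Fintype.card_fin] at this
      exact_mod_cast this
    have : (1 - 1 / (3 * (k : ℝ))) * n = n - n / (3 * (k : ℝ)) := by ring
    linarith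
  have hAn : (#A : ℝ) ≤ n := by
    exact_mod_cast (card_le_univ A).trans_eq (Fintype.card_fin n)
  have hupper : (copyCount k n (rainbowClique k) χ : ℝ) ≤
      n * M * (1 / 2 ^ (k - 2) + 1 / (3 * (k : ℝ))) := by
    calc (copyCount k n (rainbowClique k) χ : ℝ)
        ≤ ∑ x, (embCount k n (rainbowClique k) χ j x : ℝ) := by
          exact_mod_cast copyCount_le_sum_embCount k n (rainbowClique k) χ j
      _ = ∑ x ∈ A, (embCount k n (rainbowClique k) χ j x : ℝ) +
          ∑ x ∈ Aᶜ, (embCount k n (rainbowClique k) χ j x : ℝ) :=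
          (sum_add_sum_compl A _).symm
      _ ≤ #A • (M / 2 ^ (k - 2)) + #Aᶜ • M := by
          refine add_le_add (sum_le_card_nsmul _ _ _ fun x hx => ?_)
            (sum_le_card_nsmul _ _ _ fun x _ => embCount_le_div_pow k n (by omega) χ j x)
          rw [le_div_iff₀' (by positivity)]
          exact two_pow_mul_embCount_le_div_pow k n (by omega) χ hji.symm x
            ((mem_filter.1 hx).2 j)
      _ ≤ n * (M / 2 ^ (k - 2)) + n / (3 * (k : ℝ)) * M := by
          rw [nsmul_eq_mul, nsmul_eq_mul]
          gcongr
      _ = n * M * (1 / 2 ^ (k - 2) + 1 / (3 * (k : ℝ))) := by ring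
  have hden : (0 : ℝ) < (k : ℝ) ^ k - k := by
    have h : k ^ 1 < k ^ k := Nat.pow_lt_pow_right (by omega) (by omega)
    rw [pow_one] at h
    have : (k : ℝ) < (k : ℝ) ^ k := by exact_mod_cast h
    linarith
  have hlower : (n.descFactorial k : ℝ) ≤
      (k : ℝ) ^ k * (copyCount k n (rainbowClique k) χ : ℝ) := by
    rw [div_mul_eq_mul_div, div_le_iff₀ hden] at hcount
    rw [Nat.descFactorial_eq_factorial_mul_choose]
    push_cast
    refine hcount.trans ?_
    rw [mul_comm]
    gcongr
    linarith
  have hnM : n * M * ((k - 1 : ℕ) : ℝ) ^ (k - 1) = (n : ℝ) ^ k := by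
    rw [hM, div_pow, mul_assoc, div_mul_cancel₀ _ (by positivity), ← pow_succ']
    congr 1
    omega
  have hfinal : (n : ℝ) ^ k < (n : ℝ) ^ k := by
    calc (n : ℝ) ^ k ≤ 1.01 * ((k : ℝ) ^ k *
          (n * M * (1 / 2 ^ (k - 2) + 1 / (3 * (k : ℝ))))) := by
          refine hfall.trans ?_
          gcongr
          refine hlower.trans ?_
          gcongr
      _ = n * M * (1.01 * (k : ℝ) ^ k * (1 / 2 ^ (k - 2) + 1 / (3 * (k : ℝ)))) := by ring
      _ < n * M * ((k - 1 : ℕ) : ℝ) ^ (k - 1) := by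
          gcongr
          exact rainbow_numeric k hk
      _ = (n : ℝ) ^ k := hnM
  exact lt_irrefl _ hfinal
end
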